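/- arXiv:1512.02730 — 2 statements merged into one kernel-verified Lean document; each statement's English description precedes it below -/
import Mathlib

section
/- Let R and B be two disjoint finite sets of points in the plane with |B| ≤ |R| and R ∪ B in general position, and let k = ⌈|R|/|B|⌉. Then there exists a plane bichromatic tree on R ∪ B whose maximum vertex degree is at most k + 2. (This is Kaneko's Conjecture 1.) -/
open scoped Classical

noncomputable section

/-- The plane. -/
abbrev Pt : Type := ℝ × ℝ

/-- A set of points is in general position if no three of its points are collinear. -/
def GenPos (P : Set Pt) : Prop :=
  ∀ p ∈ P, ∀ q ∈ P, ∀ r ∈ P, p ≠ q → p ≠ r → q ≠ r →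
    ¬ Collinear ℝ ({p, q, r} : Set Pt)

/-- Degree of a vertex in a simple graph. -/
def deg {V : Type*} (G : SimpleGraph V) (v : V) : ℕ := (G.neighborSet v).ncard

/-- `G` is a plane bichromatic spanning tree on `R ∪ B`: a spanning tree of the
geometric complete bipartite graph `K(R,B)` (every edge joins a point of `R` and a
point of `B`), drawn with straight-line segments, no two of which cross (any point
lying on two distinct closed edges is a common endpoint of both). -/
def PlaneBichromTree (R B : Finset Pt) (G : SimpleGraph {x : Pt // x ∈ R ∪ B}) : Prop :=
  G.IsTree ∧
  (∀ u v : {x : Pt // x ∈ R ∪ B}, G.Adj u v →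
      ((u.1 ∈ R ∧ v.1 ∈ B) ∨ (u.1 ∈ B ∧ v.1 ∈ R))) ∧
  (∀ u v x y : {x : Pt // x ∈ R ∪ B}, G.Adj u v → G.Adj x y →
      s(u, v) ≠ s(x, y) →
      ∀ p : Pt, p ∈ segment ℝ u.1 v.1 → p ∈ segment ℝ x.1 y.1 →
        (p = u.1 ∨ p = v.1) ∧ (p = x.1 ∨ p = y.1))


/-! ### Combinatorics of two-coloured lists -/

/-- Number of red (`true`) entries. -/
def nr (col : Pt → Bool) (l : List Pt) : ℕ := l.countP (fun x => col x)

/-- Number of blue (`false`) entries. -/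
def nb (col : Pt → Bool) (l : List Pt) : ℕ := l.countP (fun x => !col x)

theorem nr_append (col : Pt → Bool) (l₁ l₂ : List Pt) :
    nr col (l₁ ++ l₂) = nr col l₁ + nr col l₂ := by simp [nr]

theorem nb_append (col : Pt → Bool) (l₁ l₂ : List Pt) :
    nb col (l₁ ++ l₂) = nb col l₁ + nb col l₂ := by simp [nb]

theorem nr_cons (col : Pt → Bool) (q : Pt) (l : List Pt) :
    nr col (q :: l) = nr col l + if col q then 1 else 0 := by
  simp [nr, List.countP_cons]

theorem nb_cons (col : Pt → Bool) (q : Pt) (l : List Pt) :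
    nb col (q :: l) = nb col l + if col q then 0 else 1 := by
  cases h : col q <;> simp [nb, h]

/-- Discrete crossing: linear potential `u * red + v * blue + s`. -/
theorem cross (col : Pt → Bool) (u v : ℤ) (l : List Pt) : ∀ s : ℤ, 0 < s →
    s + u * nr col l + v * nb col l ≤ 0 →
    ∃ l₁ q l₂, l = l₁ ++ q :: l₂ ∧ 0 < s + u * nr col l₁ + v * nb col l₁ ∧
      s + u * nr col l₁ + v * nb col l₁ + (if col q then u else v) ≤ 0 := by
  induction l with
  | nil => intro s hs h; simp [nr, nb] at h; omega
  | cons x l ih =>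
    intro s hs h
    rw [nr_cons, nb_cons] at h
    by_cases hx : s + (if col x then u else v) ≤ 0
    · exact ⟨[], x, l, rfl, by simpa [nr, nb] using hs, by simpa [nr, nb] using hx⟩
    · obtain ⟨l₁, q, l₂, e, h1, h2⟩ := ih (s + (if col x then u else v)) (by omega) (by
        cases hc : col x <;> simp [hc] at h ⊢ <;> linarith)
      refine ⟨x :: l₁, q, l₂, by simp [e], ?_, ?_⟩
      · rw [nr_cons, nb_cons]
        cases hc : col x <;> simp [hc] at h1 ⊢ <;> linarith
      · rw [nr_cons, nb_cons]
        cases hc : col x <;> simp [hc] at h2 ⊢ <;> linarith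

theorem hit_one (col : Pt → Bool) (k : ℕ) (l : List Pt) : ∀ s : ℤ, s ≤ 0 →
    1 ≤ s + nr col l - k * nb col l →
    ∃ l₁ l₂, l = l₁ ++ l₂ ∧ s + nr col l₁ - k * nb col l₁ = 1 := by
  induction l with
  | nil => intro s hs h; simp [nr, nb] at h; omega
  | cons x l ih =>
    intro s hs h
    rw [nr_cons, nb_cons] at h
    cases hc : col x
    · obtain ⟨l₁, l₂, e, h1⟩ := ih (s - k) (by omega) (by simp [hc] at h; linarith)
      refine ⟨x :: l₁, l₂, by simp [e], ?_⟩
      rw [nr_cons, nb_cons]; simp [hc]; linarith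
    · by_cases h0 : s = 0
      · exact ⟨[x], l, rfl, by simp [nr, nb, hc, h0]⟩
      · obtain ⟨l₁, l₂, e, h1⟩ := ih (s + 1) (by omega) (by simp [hc] at h; linarith)
        refine ⟨x :: l₁, l₂, by simp [e], ?_⟩
        rw [nr_cons, nb_cons]; simp [hc]; linarith

theorem arith_red (k r₁ b₁ r₂ b₂ : ℕ) (hf : r₁ + r₂ ≤ k * (b₁ + b₂ + 1))
    (he : b₁ + b₂ + 1 ≤ r₁ + r₂ + 1)
    (h1 : (r₁ + r₂) * b₁ < (b₁ + b₂ + 1) * r₁)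
    (h2 : (b₁ + b₂ + 1) * r₁ ≤ (r₁ + r₂) * (b₁ + 1)) :
    b₁ ≤ r₁ ∧ b₂ ≤ r₂ ∧ r₁ ≤ k * b₁ + k ∧ r₂ ≤ k * b₂ + k := by
  refine ⟨?_, ?_, ?_, ?_⟩
  · by_contra h; push Not at h; nlinarith
  · by_contra h; push Not at h; nlinarith
  · by_contra h; push Not at h
    have : (b₁ + b₂ + 1) * r₁ ≤ (b₁ + b₂ + 1) * (k * b₁ + k) := by nlinarith
    have := Nat.le_of_mul_le_mul_left this (by omega)
    omega
  · by_contra h; push Not at h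
    have : (b₁ + b₂ + 1) * r₂ ≤ (b₁ + b₂ + 1) * (k * b₂ + k) := by nlinarith
    have := Nat.le_of_mul_le_mul_left this (by omega)
    omega

theorem arith_blue (k r₁ b₁ r₂ b₂ : ℕ) (hf : r₁ + r₂ + 1 ≤ k * (b₁ + b₂) + 1)
    (he : b₁ + b₂ ≤ r₁ + r₂ + 1)
    (h1 : (b₁ + b₂) * r₁ < (r₁ + r₂ + 1) * b₁)
    (h2 : (r₁ + r₂ + 1) * b₁ ≤ (b₁ + b₂) * (r₁ + 1)) :
    r₁ ≤ k * b₁ ∧ b₁ ≤ r₁ + 1 ∧ r₂ ≤ k * b₂ ∧ b₂ ≤ r₂ + 1 := by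
  refine ⟨?_, ?_, ?_, ?_⟩
  · by_contra h; push Not at h
    have : (r₁ + r₂ + 1) * (k * b₁ + 1) ≤ (r₁ + r₂ + 1) * r₁ := by nlinarith
    have : k * ((b₁ + b₂) * r₁) ≤ k * ((r₁ + r₂ + 1) * b₁) := by gcongr
    nlinarith
  · by_contra h; push Not at h; nlinarith
  · by_contra h; push Not at h
    have : (r₁ + r₂ + 1) * (k * b₂ + 1) ≤ (r₁ + r₂ + 1) * r₂ := by nlinarith
    have : k * ((r₁ + r₂ + 1) * b₁) ≤ k * ((b₁ + b₂) * (r₁ + 1)) := by gcongr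
    nlinarith
  · by_contra h; push Not at h; nlinarith

theorem split_red (col : Pt → Bool) (k : ℕ) (hk : 1 ≤ k) (l : List Pt) (hl : l ≠ [])
    (hf : nr col l ≤ k * nb col l) (he : nb col l ≤ nr col l + 1) :
    ∃ l₁ q l₂ a a', l = l₁ ++ q :: l₂ ∧ col q = false ∧
      nb col l₁ ≤ nr col l₁ ∧ nb col l₂ ≤ nr col l₂ ∧
      nr col l₁ ≤ k * nb col l₁ + a ∧ nr col l₂ ≤ k * nb col l₂ + a' ∧
      (l₁ = [] ∨ 1 ≤ a) ∧ (l₂ = [] ∨ 1 ≤ a') ∧ a + a' ≤ k + 1 := by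
  obtain ⟨x, t, rfl⟩ := List.exists_cons_of_ne_nil hl
  cases hc : col x
  · rw [nr_cons, nb_cons] at hf he
    simp [hc] at hf he
    refine ⟨[], x, t, 0, k, rfl, hc, by simp [nb, nr], he, by simp [nb, nr], by linarith,
      Or.inl rfl, Or.inr hk, by omega⟩
  · set l := x :: t with hldef
    have hrc : nr col l = nr col t + 1 := by rw [hldef, nr_cons]; simp [hc]
    have hbc : nb col l = nb col t := by rw [hldef, nb_cons]; simp [hc]
    have hbpos : 0 < nb col l := by
      rcases Nat.eq_zero_or_pos (nb col l) with h | h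
      · rw [h] at hf; omega
      · exact h
    obtain ⟨m₁, q, l₂, e, h1, h2⟩ := cross col (nb col l) (-(nr col l : ℤ)) t (nb col l)
      (by exact_mod_cast hbpos) (by rw [hrc, hbc]; push_cast; linarith)
    have hq : col q = false := by
      by_contra hq
      simp at hq
      simp only [hq, if_true] at h2
      have : (0 : ℤ) < nb col l := by exact_mod_cast hbpos
      linarith
    have hr1 : nr col (x :: m₁) = nr col m₁ + 1 := by rw [nr_cons]; simp [hc]
    have hb1 : nb col (x :: m₁) = nb col m₁ := by rw [nb_cons]; simp [hc]
    have hel : l = (x :: m₁) ++ q :: l₂ := by rw [hldef, e]; rfl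
    have hr : nr col l = nr col (x :: m₁) + nr col l₂ := by
      rw [hel, nr_append, nr_cons _ q]; simp [hq]
    have hb : nb col l = nb col (x :: m₁) + nb col l₂ + 1 := by
      rw [hel, nb_append, nb_cons _ q]; simp [hq]; omega
    have hm : (nr col m₁ : ℤ) = nr col (x :: m₁) - 1 := by rw [hr1]; push_cast; ring
    rw [← hb1, hm] at h1 h2
    simp only [hq] at h2
    have hlast : ∃ a a', nb col (x :: m₁) ≤ nr col (x :: m₁) ∧ nb col l₂ ≤ nr col l₂ ∧
        nr col (x :: m₁) ≤ k * nb col (x :: m₁) + a ∧ nr col l₂ ≤ k * nb col l₂ + a' ∧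
        1 ≤ a ∧ 1 ≤ a' ∧ a + a' ≤ k + 1 := by
      clear hr1 hb1 hm
      generalize nr col (x :: m₁) = r₁ at *
      generalize nb col (x :: m₁) = b₁ at *
      generalize nr col l₂ = r₂ at *
      generalize nb col l₂ = b₂ at *
      rw [hr, hb] at hf he h1 h2
      obtain ⟨g1, g2, g3, g4⟩ := arith_red k r₁ b₁ r₂ b₂ hf he
        (by zify; push_cast at h1; nlinarith) (by zify; push_cast at h2; simp at h2; nlinarith)
      have hf' : r₁ + r₂ ≤ k * b₁ + k * b₂ + k := by linarith
      refine ⟨max 1 (r₁ - k * b₁), max 1 (r₂ - k * b₂), g1, g2, ?_⟩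
      generalize k * b₁ = c at *
      generalize k * b₂ = d at *
      omega
    obtain ⟨a, a', j1, j2, j3, j4, j5, j6, j7⟩ := hlast
    exact ⟨x :: m₁, q, l₂, a, a', hel, hq, j1, j2, j3, j4, Or.inr j5, Or.inr j6, j7⟩

theorem split_blue (col : Pt → Bool) (k : ℕ) (l : List Pt) (hl : l ≠ [])
    (hf : nr col l ≤ k * nb col l + 1) (he : nb col l ≤ nr col l) :
    ∃ l₁ q l₂, l = l₁ ++ q :: l₂ ∧ col q = true ∧
      nr col l₁ ≤ k * nb col l₁ ∧ nb col l₁ ≤ nr col l₁ + 1 ∧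
      nr col l₂ ≤ k * nb col l₂ ∧ nb col l₂ ≤ nr col l₂ + 1 := by
  obtain ⟨x, t, rfl⟩ := List.exists_cons_of_ne_nil hl
  cases hc : col x
  swap
  · rw [nr_cons, nb_cons] at hf he
    simp [hc] at hf he
    exact ⟨[], x, t, rfl, hc, by simp [nb, nr], by simp [nb, nr], hf, he⟩
  · set l := x :: t with hldef
    have hrc : nr col l = nr col t := by rw [hldef, nr_cons]; simp [hc]
    have hbc : nb col l = nb col t + 1 := by rw [hldef, nb_cons]; simp [hc]
    have hrpos : 0 < nr col l := by omega
    obtain ⟨m₁, q, l₂, e, h1, h2⟩ := cross col (-(nb col l : ℤ)) (nr col l) t (nr col l)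
      (by exact_mod_cast hrpos) (by rw [hrc, hbc]; push_cast; linarith)
    have hq : col q = true := by
      by_contra hq
      simp at hq
      simp only [hq, Bool.false_eq_true, if_false] at h2
      have : (0 : ℤ) < nr col l := by exact_mod_cast hrpos
      linarith
    have hr1 : nr col (x :: m₁) = nr col m₁ := by rw [nr_cons]; simp [hc]
    have hb1 : nb col (x :: m₁) = nb col m₁ + 1 := by rw [nb_cons]; simp [hc]
    have hel : l = (x :: m₁) ++ q :: l₂ := by rw [hldef, e]; rfl
    have hr : nr col l = nr col (x :: m₁) + nr col l₂ + 1 := by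
      rw [hel, nr_append, nr_cons _ q]; simp [hq]; omega
    have hb : nb col l = nb col (x :: m₁) + nb col l₂ := by
      rw [hel, nb_append, nb_cons _ q]; simp [hq]
    have hm : (nb col m₁ : ℤ) = nb col (x :: m₁) - 1 := by rw [hb1]; push_cast; ring
    rw [← hr1, hm] at h1 h2
    simp only [hq] at h2
    refine ⟨x :: m₁, q, l₂, hel, hq, ?_⟩
    generalize nr col (x :: m₁) = r₁ at *
    generalize nb col (x :: m₁) = b₁ at *
    generalize nr col l₂ = r₂ at *
    generalize nb col l₂ = b₂ at *
    rw [hr, hb] at hf he h1 h2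
    exact arith_blue k r₁ b₁ r₂ b₂ hf (by omega)
      (by zify; push_cast at h1; nlinarith) (by zify; push_cast at h2; simp at h2; nlinarith)

/-! ### Plane geometry -/

/-- Orientation determinant. -/
def cr (p x y : Pt) : ℝ := (x.1 - p.1) * (y.2 - p.2) - (x.2 - p.2) * (y.1 - p.1)

/-- A linear functional given by its coefficient vector. -/
def lin (w v : Pt) : ℝ := w.1 * v.1 + w.2 * v.2

theorem collinear_of_cr (p x y : Pt) (hx : x ≠ p) (h : cr p x y = 0) :
    Collinear ℝ ({p, x, y} : Set Pt) := by
  rw [collinear_iff_of_mem (p₀ := p) (by simp)]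
  refine ⟨x - p, ?_⟩
  unfold cr at h
  intro z hz
  simp only [Set.mem_insert_iff, Set.mem_singleton_iff] at hz
  rcases hz with rfl | rfl | rfl
  · exact ⟨0, by simp⟩
  · exact ⟨1, by simp⟩
  · by_cases h1 : x.1 - p.1 = 0
    · have h2 : x.2 - p.2 ≠ 0 := by
        intro h2; exact hx (Prod.ext (by linarith) (by linarith))
      have h3 : z.1 - p.1 = 0 := by
        rw [h1] at h; simpa [h2] using h
      refine ⟨(z.2 - p.2) / (x.2 - p.2), Prod.ext ?_ ?_⟩
      · simp [h1]; linarith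
      · simp; field_simp; ring
    · refine ⟨(z.1 - p.1) / (x.1 - p.1), Prod.ext ?_ ?_⟩
      · simp; field_simp; ring
      · simp; field_simp; linarith

theorem cr_ne (P : Set Pt) (hP : GenPos P) (p x y : Pt) (hp : p ∈ P) (hx : x ∈ P) (hy : y ∈ P)
    (h1 : p ≠ x) (h2 : p ≠ y) (h3 : x ≠ y) : cr p x y ≠ 0 := fun h =>
  hP p hp x hx y hy h1 h2 h3 (collinear_of_cr p x y h1.symm h)

theorem seg_end (P : Set Pt) (hP : GenPos P) (c u v : Pt) (hc : c ∈ P) (hu : u ∈ P) (hv : v ∈ P)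
    (h : c ∈ segment ℝ u v) : c = u ∨ c = v := by
  by_contra hne
  push Not at hne
  have huv : u ≠ v := by
    rintro rfl; simp at h; exact hne.1 h
  refine cr_ne P hP c u v hc hu hv hne.1 hne.2 huv ?_
  obtain ⟨a, b, ha, hb, hab, rfl⟩ := h
  obtain rfl : b = 1 - a := by linarith
  simp [cr]; ring

/-- Sorting along an injective key. -/
theorem exists_sorted (key : Pt → ℝ) (l : List Pt) (hl : l.Nodup)
    (hinj : ∀ x ∈ l, ∀ y ∈ l, key x = key y → x = y) :
    ∃ l' : List Pt, l'.Perm l ∧ l'.Pairwise (fun x y => key x < key y) := by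
  refine ⟨l.mergeSort (fun x y => decide (key x ≤ key y)), List.mergeSort_perm _ _, ?_⟩
  have hp := List.mergeSort_perm l (fun x y => decide (key x ≤ key y))
  have h1 := List.pairwise_mergeSort (le := fun x y => decide (key x ≤ key y))
    (by intro a b c; simp; exact le_trans) (by intro a b; simpa using le_total _ _) l
  have h2 : (l.mergeSort (fun x y => decide (key x ≤ key y))).Nodup := hp.nodup_iff.2 hl
  refine List.Pairwise.imp_of_mem ?_ (h1.and h2)
  rintro a b ha hb ⟨hab, hne⟩
  simp at hab
  exact lt_of_le_of_ne hab fun h => hne (hinj a (hp.mem_iff.1 ha) b (hp.mem_iff.1 hb) h)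

theorem exists_radial (P : Set Pt) (hP : GenPos P) (p : Pt) (hp : p ∈ P) (l : List Pt)
    (hl : l.Nodup) (hlP : ∀ x ∈ l, x ∈ P) (w : Pt) (hw : ∀ x ∈ l, 0 < lin w (x - p)) :
    ∃ l' : List Pt, l'.Perm l ∧ l'.Pairwise (fun x y => 0 < cr p x y) := by
  have hpne : ∀ x ∈ l, p ≠ x := by
    rintro x hx rfl; have := hw _ hx; simp [lin] at this
  let key : Pt → ℝ := fun x => (-w.2 * (x.1 - p.1) + w.1 * (x.2 - p.2)) / lin w (x - p)
  have hid : ∀ x y : Pt, (-w.2 * (y.1 - p.1) + w.1 * (y.2 - p.2)) * lin w (x - p) -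
      (-w.2 * (x.1 - p.1) + w.1 * (x.2 - p.2)) * lin w (y - p) =
      (w.1 ^ 2 + w.2 ^ 2) * cr p x y := by
    intro x y; simp [lin, cr]; ring
  have hwpos : ∀ x ∈ l, 0 < w.1 ^ 2 + w.2 ^ 2 := by
    intro x hx
    have := hw x hx
    by_contra h
    have h1 : w.1 = 0 := by nlinarith [sq_nonneg w.1, sq_nonneg w.2]
    have h2 : w.2 = 0 := by nlinarith [sq_nonneg w.1, sq_nonneg w.2]
    simp [lin, h1, h2] at this
  obtain ⟨l', h1, h2⟩ := exists_sorted key l hl (by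
    intro x hx y hy hxy
    by_contra hne
    refine cr_ne P hP p x y hp (hlP x hx) (hlP y hy) (hpne x hx) (hpne y hy) hne ?_
    have e := hid x y
    simp only [key] at hxy
    rw [div_eq_div_iff (hw x hx).ne' (hw y hy).ne'] at hxy
    rw [hxy, sub_self] at e
    have := hwpos x hx
    rcases mul_eq_zero.1 e.symm with h | h
    · exact absurd h this.ne'
    · exact h)
  refine ⟨l', h1, List.Pairwise.imp_of_mem ?_ h2⟩
  intro x y hx hy hxy
  have hx := h1.mem_iff.1 hx
  have hy := h1.mem_iff.1 hy
  simp only [key] at hxy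
  rw [div_lt_div_iff₀ (hw x hx) (hw y hy)] at hxy
  have e := hid x y
  have := hwpos x hx
  by_contra hcr
  nlinarith

/-! ### Plane trees as edge sets -/

/-- Number of edges at a vertex. -/
def dg (E : Finset (Pt × Pt)) (v : Pt) : ℕ := (E.filter (fun e => e.1 = v ∨ e.2 = v)).card

/-- `E` is the edge set of a plane bichromatic tree on `V`. -/
structure PT (col : Pt → Bool) (V : Set Pt) (E : Finset (Pt × Pt)) : Prop where
  sub : ∀ e ∈ E, e.1 ∈ V ∧ e.2 ∈ V ∧ col e.1 ≠ col e.2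
  fin : V.Finite
  card : E.card + 1 ≤ V.ncard
  conn : ∀ Q : Pt → Prop, (∀ e ∈ E, (Q e.1 ↔ Q e.2)) → ∀ u ∈ V, ∀ v ∈ V, Q u → Q v
  plane : ∀ e ∈ E, ∀ e' ∈ E, e ≠ e' → ∀ x, x ∈ segment ℝ e.1 e.2 → x ∈ segment ℝ e'.1 e'.2 →
    (x = e.1 ∨ x = e.2) ∧ (x = e'.1 ∨ x = e'.2)

theorem dg_zero {col : Pt → Bool} {V : Set Pt} {E : Finset (Pt × Pt)} (h : PT col V E) (v : Pt)
    (hv : v ∉ V) : dg E v = 0 := by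
  unfold dg
  rw [Finset.card_eq_zero, Finset.filter_eq_empty_iff]
  rintro e he (rfl | rfl)
  · exact hv (h.sub e he).1
  · exact hv (h.sub e he).2.1

theorem dg_union (E₁ E₂ : Finset (Pt × Pt)) (v : Pt) : dg (E₁ ∪ E₂) v ≤ dg E₁ v + dg E₂ v := by
  unfold dg
  rw [Finset.filter_union]
  exact Finset.card_union_le _ _

theorem lin_seg (w c u v : Pt) (a b : ℝ) (hab : a + b = 1) :
    lin w (a • u + b • v - c) = a * lin w (u - c) + b * lin w (v - c) := by
  obtain rfl : b = 1 - a := by linarith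
  simp [lin]; ring

theorem glue {col : Pt → Bool} {P V₁ V₂ : Set Pt} {E₁ E₂ : Finset (Pt × Pt)} (hP : GenPos P)
    (h₁ : PT col V₁ E₁) (h₂ : PT col V₂ E₂) (hV₁ : V₁ ⊆ P) (c w : Pt)
    (c₁ : c ∈ V₁) (c₂ : c ∈ V₂) (s₁ : ∀ x ∈ V₁, lin w (x - c) ≤ 0)
    (s₂ : ∀ x ∈ V₂, x = c ∨ 0 < lin w (x - c)) : PT col (V₁ ∪ V₂) (E₁ ∪ E₂) := by
  have key : ∀ e ∈ E₁, ∀ e' ∈ E₂, ∀ x, x ∈ segment ℝ e.1 e.2 → x ∈ segment ℝ e'.1 e'.2 →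
      (x = e.1 ∨ x = e.2) ∧ (x = e'.1 ∨ x = e'.2) := by
    intro e he e' he' x hx hx'
    have hneg : lin w (x - c) ≤ 0 := by
      obtain ⟨a, b, ha, hb, hab, rfl⟩ := hx
      rw [lin_seg _ _ _ _ _ _ hab]
      have := s₁ _ (h₁.sub e he).1
      have := s₁ _ (h₁.sub e he).2.1
      nlinarith
    have hfin : x = c ∧ (x = e'.1 ∨ x = e'.2) := by
      have h0 : lin w (c - c) = 0 := by simp [lin]
      obtain ⟨a, b, ha, hb, hab, rfl⟩ := hx'
      rw [lin_seg _ _ _ _ _ _ hab] at hneg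
      have d : e'.1 ≠ e'.2 := fun h => (h₂.sub e' he').2.2 (by rw [h])
      rcases s₂ _ (h₂.sub e' he').1 with q1 | q1 <;> rcases s₂ _ (h₂.sub e' he').2.1 with q2 | q2
      · exact absurd (q1.trans q2.symm) d
      · rw [q1, h0] at hneg
        have : b = 0 := by nlinarith
        obtain rfl : a = 1 := by linarith
        simp [this, q1]
      · rw [q2, h0] at hneg
        have : a = 0 := by nlinarith
        obtain rfl : b = 1 := by linarith
        simp [this, q2]
      · exfalso
        rcases ha.lt_or_eq with h | h
        · have := mul_pos h q1
          have := mul_nonneg hb q2.le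
          linarith
        · obtain rfl : b = 1 := by linarith
          rw [← h] at hneg
          linarith
    refine ⟨?_, hfin.2⟩
    rw [hfin.1] at hx ⊢
    exact seg_end P hP c _ _ (hV₁ c₁) (hV₁ (h₁.sub e he).1) (hV₁ (h₁.sub e he).2.1) hx
  refine ⟨?_, h₁.fin.union h₂.fin, ?_, ?_, ?_⟩
  · intro e he
    rcases Finset.mem_union.1 he with h | h
    · have := h₁.sub e h; exact ⟨Or.inl this.1, Or.inl this.2.1, this.2.2⟩
    · have := h₂.sub e h; exact ⟨Or.inr this.1, Or.inr this.2.1, this.2.2⟩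
  · have hi : V₁ ∩ V₂ = {c} := by
      ext x
      constructor
      · rintro ⟨a, b⟩
        rcases s₂ x b with h | h
        · exact h
        · exact absurd (s₁ x a) (not_le.2 h)
      · rintro rfl; exact ⟨c₁, c₂⟩
    have h := Set.ncard_union_add_ncard_inter V₁ V₂ h₁.fin h₂.fin
    rw [hi, Set.ncard_singleton] at h
    have := Finset.card_union_le E₁ E₂
    have := h₁.card
    have := h₂.card
    omega
  · intro Q hQ
    have g₁ := h₁.conn Q fun e he => hQ e (Finset.mem_union_left _ he)
    have g₂ := h₂.conn Q fun e he => hQ e (Finset.mem_union_right _ he)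
    rintro u (hu | hu) v (hv | hv) h
    · exact g₁ u hu v hv h
    · exact g₂ c c₂ v hv (g₁ u hu c c₁ h)
    · exact g₁ c c₁ v hv (g₂ u hu c c₂ h)
    · exact g₂ u hu v hv h
  · intro e he e' he' hne x hx hx'
    rcases Finset.mem_union.1 he with h | h <;> rcases Finset.mem_union.1 he' with h' | h'
    · exact h₁.plane e h e' h' hne x hx hx'
    · exact key e h e' h' x hx hx'
    · exact (key e' h' e h x hx' hx).symm
    · exact h₂.plane e h e' h' hne x hx hx'

theorem PT_single (col : Pt → Bool) (p : Pt) : PT col {p} ∅ := by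
  refine ⟨by simp, by simp, by simp, ?_, by simp⟩
  rintro Q - u rfl v rfl h
  exact h

theorem PT_edge (col : Pt → Bool) (p q : Pt) (h : col p ≠ col q) : PT col {p, q} {(p, q)} := by
  have hpq : p ≠ q := by rintro rfl; exact h rfl
  refine ⟨by simpa using h, by simp, by simp [Set.ncard_pair hpq], ?_, ?_⟩
  · intro Q hQ
    have := hQ (p, q) (by simp)
    simp at this
    rintro u (rfl | rfl) v (rfl | rfl) <;> tauto
  · intro e he e' he' hne
    simp at he he'
    exact absurd (he.trans he'.symm) hne

/-- Rooted solution. -/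
def Sol (col : Pt → Bool) (K : ℕ) (p : Pt) (l : List Pt) (d : ℕ) : Prop :=
  ∃ E, PT col {x | x = p ∨ x ∈ l} E ∧ dg E p ≤ d ∧ ∀ v, v ≠ p → dg E v ≤ K

theorem sol_perm {col : Pt → Bool} {K : ℕ} {p : Pt} {l l' : List Pt} {d : ℕ} (h : l'.Perm l)
    (hs : Sol col K p l' d) : Sol col K p l d := by
  unfold Sol at *
  simpa only [h.mem_iff] using hs

theorem sol_nil (col : Pt → Bool) (K : ℕ) (p : Pt) (d : ℕ) : Sol col K p [] d := by
  refine ⟨∅, ?_, by simp [dg], by simp [dg]⟩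
  convert PT_single col p using 1
  ext; simp

/-- Two solutions with the same root, separated by a line through the root. -/
theorem sol_split {col : Pt → Bool} {K : ℕ} {P : Set Pt} (hP : GenPos P) {p : Pt}
    {l₁ l₂ : List Pt} {a b : ℕ} (hp : p ∈ P) (hl₁ : ∀ x ∈ l₁, x ∈ P)
    (hpl₂ : p ∉ l₂)
    (hne : l₁ ≠ []) (hs : (l₁ ++ l₂).Pairwise (fun x y => 0 < cr p x y))
    (h₁ : Sol col K p l₁ a) (h₂ : Sol col K p l₂ b) : Sol col K p (l₁ ++ l₂) (a + b) := by
  obtain ⟨E₁, t₁, d₁, k₁⟩ := h₁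
  obtain ⟨E₂, t₂, d₂, k₂⟩ := h₂
  rw [List.pairwise_append] at hs
  obtain ⟨m, q, rfl⟩ : ∃ m q, l₁ = m ++ [q] :=
    ⟨l₁.dropLast, l₁.getLast hne, (List.dropLast_append_getLast hne).symm⟩
  have hlin : ∀ x, lin (-(q.2 - p.2), q.1 - p.1) (x - p) = cr p q x := by
    intro x; simp [lin, cr]; ring
  have hcr0 : cr p q p = 0 := by simp [cr]
  have hcrq : cr p q q = 0 := by simp [cr]; ring
  have hanti : ∀ x, cr p q x = - cr p x q := by intro x; simp [cr]; ring
  have g := glue hP t₁ t₂ (by rintro x (rfl | hx); exacts [hp, hl₁ x hx]) p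
    (-(q.2 - p.2), q.1 - p.1) (Or.inl rfl) (Or.inl rfl) (by
      rintro x (rfl | hx)
      · rw [hlin, hcr0]
      · rw [hlin]
        rw [List.mem_append] at hx
        rcases hx with hx | hx
        · have := (List.pairwise_append.1 hs.1).2.2 x hx q (by simp)
          rw [hanti]; linarith
        · simp at hx; rw [hx, hcrq]) (by
      rintro x (rfl | hx)
      · exact Or.inl rfl
      · right; rw [hlin]; exact hs.2.2 q (by simp) x hx)
  refine ⟨E₁ ∪ E₂, ?_, (dg_union _ _ _).trans (by omega), ?_⟩
  · convert g using 1
    ext x; simp; tauto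
  · intro v hv
    by_cases hv1 : v ∈ m ++ [q]
    · have hv2 : v ∉ l₂ := by
        intro hv2
        have := hs.2.2 v hv1 v hv2
        simp [cr] at this
        linarith
      have := dg_zero t₂ v (by rintro (h | h); exacts [hv h, hv2 h])
      exact (dg_union _ _ _).trans (by rw [this]; exact k₁ v hv)
    · have := dg_zero t₁ v (by rintro (h | h); exacts [hv h, hv1 h])
      exact (dg_union _ _ _).trans (by rw [this, zero_add]; exact k₂ v hv)

/-- The root `p` joined to `q`, which is the root of solutions on both sides of `pq`. -/
theorem sol_join {col : Pt → Bool} {K : ℕ} {P : Set Pt} (hP : GenPos P) {p q : Pt}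
    {l₁ l₂ : List Pt} {a b : ℕ} (hp : p ∈ P) (hq : q ∈ P) (hl₁ : ∀ x ∈ l₁, x ∈ P)
    (hcol : col p ≠ col q) (hpl₁ : p ∉ l₁) (hpl₂ : p ∉ l₂)
    (hs : (l₁ ++ q :: l₂).Pairwise (fun x y => 0 < cr p x y))
    (h₁ : Sol col K q l₁ a) (h₂ : Sol col K q l₂ b) (hK : a + b + 1 ≤ K) :
    Sol col K p (l₁ ++ q :: l₂) 1 := by
  obtain ⟨E₁, t₁, d₁, k₁⟩ := h₁
  obtain ⟨E₂, t₂, d₂, k₂⟩ := h₂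
  have hpq : p ≠ q := by rintro rfl; exact hcol rfl
  rw [List.pairwise_append, List.pairwise_cons] at hs
  have hlin : ∀ x, lin (-(q.2 - p.2), q.1 - p.1) (x - q) = cr p q x := by
    intro x; simp [lin, cr]; ring
  have hlin' : ∀ x, lin ((q.2 - p.2), -(q.1 - p.1)) (x - q) = - cr p q x := by
    intro x; simp [lin, cr]; ring
  have hcr0 : cr p q p = 0 := by simp [cr]
  have hcrq : cr p q q = 0 := by simp [cr]; ring
  have hanti : ∀ x, cr p q x = - cr p x q := by intro x; simp [cr]; ring
  have hL : ∀ x ∈ l₁, cr p q x < 0 := by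
    intro x hx; rw [hanti]; have := hs.2.2 x hx q (by simp); linarith
  have hR : ∀ x ∈ l₂, 0 < cr p q x := hs.2.1.1
  have g₁ := glue hP (PT_edge col p q hcol) t₁ (by rintro x (rfl | rfl); exacts [hp, hq]) q
    ((q.2 - p.2), -(q.1 - p.1)) (Or.inr rfl) (Or.inl rfl) (by
      rintro x (rfl | rfl)
      · rw [hlin', hcr0]; simp
      · rw [hlin', hcrq]; simp) (by
      rintro x (rfl | hx)
      · exact Or.inl rfl
      · right; rw [hlin']; linarith [hL x hx])
  have g₂ := glue hP g₁ t₂ (by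
      rintro x ((rfl | rfl) | (rfl | hx)); exacts [hp, hq, hq, hl₁ x hx]) q
    (-(q.2 - p.2), q.1 - p.1) (Or.inl (Or.inr rfl)) (Or.inl rfl) (by
      rintro x ((rfl | rfl) | (rfl | hx))
      · rw [hlin, hcr0]
      · rw [hlin, hcrq]
      · rw [hlin, hcrq]
      · rw [hlin]; exact (hL x hx).le) (by
      rintro x (rfl | hx)
      · exact Or.inl rfl
      · right; rw [hlin]; exact hR x hx)
  have hdu : ∀ v, dg ({(p, q)} ∪ E₁ ∪ E₂) v ≤ dg {(p, q)} v + dg E₁ v + dg E₂ v := by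
    intro v
    have := dg_union ({(p, q)} ∪ E₁) E₂ v
    have := dg_union {(p, q)} E₁ v
    omega
  have he1 : ∀ v, dg {(p, q)} v ≤ 1 := by
    intro v; unfold dg; exact (Finset.card_filter_le _ _).trans (by simp)
  have he0 : ∀ v, v ≠ p → v ≠ q → dg {(p, q)} v = 0 := by
    intro v h1 h2
    exact dg_zero (PT_edge col p q hcol) v (by rintro (h | h); exacts [h1 h, h2 h])
  have z₁ : ∀ v, v ≠ q → v ∉ l₁ → dg E₁ v = 0 := fun v h1 h2 =>
    dg_zero t₁ v (by rintro (h | h); exacts [h1 h, h2 h])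
  have z₂ : ∀ v, v ≠ q → v ∉ l₂ → dg E₂ v = 0 := fun v h1 h2 =>
    dg_zero t₂ v (by rintro (h | h); exacts [h1 h, h2 h])
  refine ⟨{(p, q)} ∪ E₁ ∪ E₂, ?_, ?_, ?_⟩
  · convert g₂ using 1
    ext x; simp; tauto
  · have := hdu p
    rw [z₁ p hpq hpl₁, z₂ p hpq hpl₂] at this
    exact this.trans (he1 p)
  · intro v hv
    have hd := hdu v
    by_cases hvq : v = q
    · subst hvq
      have := he1 v
      omega
    · rw [he0 v hv hvq] at hd
      by_cases hv1 : v ∈ l₁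
      · have hv2 : v ∉ l₂ := fun hv2 => by linarith [hL v hv1, hR v hv2]
        rw [z₂ v hvq hv2] at hd
        have := k₁ v hvq
        omega
      · rw [z₁ v hvq hv1] at hd
        have := k₂ v hvq
        omega

theorem nr_perm (col : Pt → Bool) {l l' : List Pt} (h : l'.Perm l) : nr col l' = nr col l :=
  h.countP_eq _

theorem nb_perm (col : Pt → Bool) {l l' : List Pt} (h : l'.Perm l) : nb col l' = nb col l :=
  h.countP_eq _

theorem Sol.mono {col : Pt → Bool} {K : ℕ} {p : Pt} {l : List Pt} {d d' : ℕ} (h : d ≤ d')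
    (hs : Sol col K p l d) : Sol col K p l d' := by
  obtain ⟨E, h1, h2, h3⟩ := hs
  exact ⟨E, h1, h2.trans h, h3⟩

/-- The rooted induction. -/
theorem rooted (col : Pt → Bool) (k : ℕ) (hk : 1 ≤ k) (P : Set Pt) (hP : GenPos P) (n : ℕ) :
    ∀ (p : Pt) (l : List Pt), l.length ≤ n → l.Nodup → p ∈ P → (∀ x ∈ l, x ∈ P) →
      ∀ w : Pt, (∀ x ∈ l, 0 < lin w (x - p)) →
      (col p = true → nr col l ≤ k * nb col l → nb col l ≤ nr col l + 1 →
        Sol col (k + 2) p l 1) ∧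
      (col p = false → ∀ a, nb col l ≤ nr col l → nr col l ≤ k * nb col l + a →
        (l = [] ∨ 1 ≤ a) → Sol col (k + 2) p l a) := by
  induction n with
  | zero =>
    intro p l hn _ _ _ _ _
    obtain rfl : l = [] := List.length_eq_zero_iff.1 (by omega)
    exact ⟨fun _ _ _ => sol_nil _ _ _ _, fun _ _ _ _ _ => sol_nil _ _ _ _⟩
  | succ n ih =>
    intro p l hn hnd hp hlP w hw
    by_cases hl : l = []
    · subst hl
      exact ⟨fun _ _ _ => sol_nil _ _ _ _, fun _ _ _ _ _ => sol_nil _ _ _ _⟩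
    obtain ⟨l', hperm, hs⟩ := exists_radial P hP p hp l hnd hlP w hw
    rw [← nr_perm col hperm, ← nb_perm col hperm]
    have hl' : l' ≠ [] := fun h => hl (by rw [h] at hperm; exact hperm.symm.eq_nil)
    have hn' : l'.length ≤ n + 1 := by rw [hperm.length_eq]; exact hn
    have hnd' : l'.Nodup := hperm.nodup_iff.2 hnd
    have hlP' : ∀ x ∈ l', x ∈ P := fun x hx => hlP x (hperm.mem_iff.1 hx)
    have hw' : ∀ x ∈ l', 0 < lin w (x - p) := fun x hx => hw x (hperm.mem_iff.1 hx)
    have hpl : p ∉ l' := by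
      intro h; have := hw' p h; simp [lin] at this
    -- the two sides of the line through `p` and a point `q` of the list
    have hleft : ∀ l₁ q l₂, l' = l₁ ++ q :: l₂ →
        ∀ x ∈ l₁, 0 < lin ((q.2 - p.2), -(q.1 - p.1)) (x - q) := by
      intro l₁ q l₂ e x hx
      rw [e, List.pairwise_append] at hs
      have := hs.2.2 x hx q (by simp)
      have e2 : lin ((q.2 - p.2), -(q.1 - p.1)) (x - q) = cr p x q := by simp [lin, cr]; ring
      rw [e2]; exact this
    have hright : ∀ l₁ q l₂, l' = l₁ ++ q :: l₂ →
        ∀ x ∈ l₂, 0 < lin (-(q.2 - p.2), (q.1 - p.1)) (x - q) := by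
      intro l₁ q l₂ e x hx
      rw [e, List.pairwise_append, List.pairwise_cons] at hs
      have := hs.2.1.1 x hx
      have e2 : lin (-(q.2 - p.2), (q.1 - p.1)) (x - q) = cr p q x := by simp [lin, cr]; ring
      rw [e2]; exact this
    constructor
    · intro hcp hf he
      refine sol_perm hperm ?_
      obtain ⟨l₁, q, l₂, a, a', e, hq, e1, e2, f1, f2, o1, o2, ha⟩ :=
        split_red col k hk l' hl' hf he
      have i₁ := (ih q l₁ (by simp [e] at hn'; omega)
        (by rw [e] at hnd'; exact hnd'.of_append_left) (hlP' q (by simp [e]))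
        (fun x hx => hlP' x (by simp [e, hx])) _ (hleft l₁ q l₂ e)).2 hq a e1 f1 o1
      have i₂ := (ih q l₂ (by simp [e] at hn'; omega)
        (by rw [e] at hnd'; exact (List.nodup_cons.1 hnd'.of_append_right).2)
        (hlP' q (by simp [e]))
        (fun x hx => hlP' x (by simp [e, hx])) _ (hright l₁ q l₂ e)).2 hq a' e2 f2 o2
      rw [e] at hs ⊢
      exact sol_join hP hp (hlP' q (by simp [e])) (fun x hx => hlP' x (by simp [e, hx]))
        (by rw [hcp, hq]; decide) (fun h => hpl (by simp [e, h])) (fun h => hpl (by simp [e, h]))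
        hs i₁ i₂ (by omega)
    · intro hcp a he hf ha
      have ha : 1 ≤ a := ha.resolve_left hl
      refine sol_perm hperm ?_
      by_cases hf1 : nr col l' ≤ k * nb col l' + 1
      · obtain ⟨l₁, q, l₂, e, hq, f1, e1, f2, e2⟩ := split_blue col k l' hl' hf1 he
        have i₁ := (ih q l₁ (by simp [e] at hn'; omega)
          (by rw [e] at hnd'; exact hnd'.of_append_left) (hlP' q (by simp [e]))
          (fun x hx => hlP' x (by simp [e, hx])) _ (hleft l₁ q l₂ e)).1 hq f1 e1
        have i₂ := (ih q l₂ (by simp [e] at hn'; omega)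
          (by rw [e] at hnd'; exact (List.nodup_cons.1 hnd'.of_append_right).2)
          (hlP' q (by simp [e]))
          (fun x hx => hlP' x (by simp [e, hx])) _ (hright l₁ q l₂ e)).1 hq f2 e2
        refine Sol.mono ha ?_
        rw [e] at hs ⊢
        exact sol_join hP hp (hlP' q (by simp [e])) (fun x hx => hlP' x (by simp [e, hx]))
          (by rw [hcp, hq]; decide) (fun h => hpl (by simp [e, h]))
          (fun h => hpl (by simp [e, h])) hs i₁ i₂ (by omega)
      · obtain ⟨l₁, l₂, e, h1⟩ := hit_one col k l' 0 le_rfl (by push Not at hf1; zify at hf1; omega)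
        have h1' : nr col l₁ = k * nb col l₁ + 1 := by zify; linarith
        have hr : nr col l' = nr col l₁ + nr col l₂ := by rw [e, nr_append]
        have hb : k * nb col l' = k * nb col l₁ + k * nb col l₂ := by
          rw [e, nb_append, mul_add]
        have hk1 : nb col l₁ ≤ k * nb col l₁ := Nat.le_mul_of_pos_left _ hk
        have hk2 : nb col l₂ ≤ k * nb col l₂ := Nat.le_mul_of_pos_left _ hk
        have n₁ : l₁ ≠ [] := by rintro rfl; simp [nr] at h1'
        have n₂ : l₂ ≠ [] := by
          rintro rfl
          have z1 : nr col [] = 0 := rfl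
          have z2 : nb col [] = 0 := rfl
          rw [z1] at hr
          rw [z2] at hb
          omega
        have p₁ := List.length_pos_iff.2 n₁
        have p₂ := List.length_pos_iff.2 n₂
        have i₁ := (ih p l₁ (by simp [e] at hn'; omega)
          (by rw [e] at hnd'; exact hnd'.of_append_left) hp
          (fun x hx => hlP' x (by simp [e, hx])) w
          (fun x hx => hw' x (by simp [e, hx]))).2 hcp 1 (by omega) (by omega) (Or.inr le_rfl)
        have i₂ := (ih p l₂ (by simp [e] at hn'; omega)
          (by rw [e] at hnd'; exact hnd'.of_append_right) hp
          (fun x hx => hlP' x (by simp [e, hx])) w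
          (fun x hx => hw' x (by simp [e, hx]))).2 hcp (a - 1) (by omega) (by omega)
            (Or.inr (by omega))
        have hfin := sol_split hP hp (fun x hx => hlP' x (by simp [e, hx]))
          (fun h => hpl (by simp [e, h])) n₁ (by rw [e] at hs; exact hs) i₁ i₂
        rw [e]
        exact hfin.mono (by omega)

/-- A finite nonempty set has a strictly extreme point. -/
theorem exists_extreme (S : Finset Pt) (hS : S.Nonempty) :
    ∃ p ∈ S, ∃ w : Pt, ∀ x ∈ S, x ≠ p → 0 < lin w (x - p) := by
  have hfin : (⋃ e ∈ (S ×ˢ S).filter (fun e => e.1 ≠ e.2),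
      {t : ℝ | (e.1.1 - e.2.1) + t * (e.1.2 - e.2.2) = 0}).Finite := by
    refine Set.Finite.biUnion (Finset.finite_toSet _) ?_
    rintro ⟨x, y⟩ he
    have hne : x ≠ y := by simp at he; exact he.2
    refine Set.Subsingleton.finite ?_
    intro s hs t ht
    simp only [Set.mem_ofPred_eq] at hs ht
    by_cases h2 : x.2 - y.2 = 0
    · rw [h2] at hs
      exact absurd (Prod.ext (by linarith) (by linarith)) hne
    · exact mul_right_cancel₀ h2 (by linarith)
  obtain ⟨t, ht⟩ := hfin.infinite_compl.nonempty
  obtain ⟨p, hp, hmin⟩ := S.exists_min_image (fun x => x.1 + t * x.2) hS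
  refine ⟨p, hp, (1, t), fun x hx hne => ?_⟩
  have h1 := hmin x hx
  have h2 : (x.1 - p.1) + t * (x.2 - p.2) ≠ 0 := by
    intro h
    refine ht (Set.mem_biUnion (x := (x, p)) ?_ h)
    simp [hx, hp, hne]
  have h3 : lin (1, t) (x - p) = (x.1 - p.1) + t * (x.2 - p.2) := by simp [lin]
  rw [h3]
  exact lt_of_le_of_ne (by linarith) h2.symm

/-- Kaneko's Conjecture 1. If `|B| ≤ |R|`, `R ∪ B` is in general
position and `k = ⌈|R|/|B|⌉`, then there is a plane bichromatic tree on `R ∪ B`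
of maximum degree at most `k + 2`. -/
theorem statement_6 (R B : Finset Pt) (hdisj : Disjoint R B) (hB : B.Nonempty)
    (hBR : B.card ≤ R.card) (hgp : GenPos (↑(R ∪ B) : Set Pt))
    (k : ℕ) (hk : (k : ℤ) = ⌈(R.card : ℚ) / (B.card : ℚ)⌉) :
    ∃ G : SimpleGraph {x : Pt // x ∈ R ∪ B},
      PlaneBichromTree R B G ∧ ∀ v, deg G v ≤ k + 2 := by
  have hBpos : 0 < B.card := hB.card_pos
  have hBq : (0 : ℚ) < B.card := by exact_mod_cast hBpos
  have hkR : R.card ≤ k * B.card := by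
    have h1 : (R.card : ℚ) / B.card ≤ k := by
      have := Int.le_ceil ((R.card : ℚ) / B.card)
      rw [← hk] at this
      exact_mod_cast this
    rw [div_le_iff₀ hBq] at h1
    exact_mod_cast h1
  have hk1 : 1 ≤ k := by
    rcases Nat.eq_zero_or_pos k with h | h
    · rw [h] at hkR; omega
    · exact h
  obtain ⟨p, hp, w, hw⟩ := exists_extreme (R ∪ B) (hB.mono Finset.subset_union_right)
  let col : Pt → Bool := fun x => decide (x ∈ R)
  have hcB : ∀ x ∈ R ∪ B, col x = false → x ∈ B := by
    intro x hx h
    simp [col] at h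
    exact (Finset.mem_union.1 hx).resolve_left h
  have hcR : ∀ x, col x = true → x ∈ R := by
    intro x h; simpa [col] using h
  let l : List Pt := ((R ∪ B).erase p).toList
  have hlmem : ∀ x, x ∈ l ↔ x ≠ p ∧ x ∈ R ∪ B := by intro x; simp [l]
  have hnr : nr col l = (R.erase p).card := by
    unfold nr
    rw [List.countP_eq_length_filter, ← List.toFinset_card_of_nodup
      ((Finset.nodup_toList _).filter _)]
    congr 1
    ext x
    have : x ∈ l ↔ _ := hlmem x
    simp [this, col]
    tauto
  have hnb : nb col l = (B.erase p).card := by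
    unfold nb
    rw [List.countP_eq_length_filter, ← List.toFinset_card_of_nodup
      ((Finset.nodup_toList _).filter _)]
    congr 1
    ext x
    have : x ∈ l ↔ _ := hlmem x
    have : x ∈ R → x ∉ B := fun h h' => Finset.disjoint_left.1 hdisj h h'
    simp [hlmem x, col]
    tauto
  have hroot := rooted col k hk1 (↑(R ∪ B) : Set Pt) hgp l.length p l le_rfl
    (Finset.nodup_toList _) (by exact_mod_cast hp)
    (fun x hx => by exact_mod_cast ((hlmem x).1 hx).2) w
    (fun x hx => hw x ((hlmem x).1 hx).2 ((hlmem x).1 hx).1)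
  have hsol : Sol col (k + 2) p l (k + 2) := by
    cases hc : col p
    · have hpB := hcB p hp hc
      have hpR : p ∉ R := fun h => Finset.disjoint_left.1 hdisj h hpB
      have e1 : nr col l = R.card := by rw [hnr, Finset.erase_eq_of_notMem hpR]
      have e2 : nb col l + 1 = B.card := by rw [hnb, Finset.card_erase_add_one hpB]
      refine (hroot.2 hc k (by omega) ?_ (Or.inr hk1)).mono (by omega)
      rw [e1]; rw [← e2] at hkR; linarith
    · have hpR := hcR p hc
      have hpB : p ∉ B := fun h => Finset.disjoint_left.1 hdisj hpR h
      have e1 : nb col l = B.card := by rw [hnb, Finset.erase_eq_of_notMem hpB]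
      have e2 : nr col l + 1 = R.card := by rw [hnr, Finset.card_erase_add_one hpR]
      refine (hroot.1 hc ?_ (by omega)).mono (by omega)
      rw [e1]; omega
  obtain ⟨E, hE, hd1, hd2⟩ := hsol
  have hV : ∀ x, (x ∈ {x | x = p ∨ x ∈ l}) ↔ x ∈ R ∪ B := by
    intro x
    simp only [Set.mem_ofPred_eq, hlmem]
    constructor
    · rintro (rfl | h)
      · exact hp
      · exact h.2
    · intro h
      by_cases hx : x = p
      · exact Or.inl hx
      · exact Or.inr ⟨hx, h⟩
  have hVeq : {x | x = p ∨ x ∈ l} = (↑(R ∪ B) : Set Pt) := by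
    ext x; rw [hV]; simp
  rw [hVeq] at hE
  have hdeg : ∀ v, dg E v ≤ k + 2 := by
    intro v
    by_cases hv : v = p
    · rw [hv]; exact hd1
    · exact hd2 v hv
  let G : SimpleGraph {x : Pt // x ∈ R ∪ B} :=
    { Adj := fun u v => (u.1, v.1) ∈ E ∨ (v.1, u.1) ∈ E
      symm := ⟨fun u v h => h.symm⟩
      loopless := ⟨fun u h => by
        rcases h with h | h <;> exact (hE.sub _ h).2.2 rfl⟩ }
  have hGconn : G.Connected := by
    have : Nonempty {x : Pt // x ∈ R ∪ B} := ⟨⟨p, hp⟩⟩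
    refine ⟨fun u v => ?_⟩
    have := hE.conn (fun x => ∃ h : x ∈ R ∪ B, G.Reachable u ⟨x, h⟩) (by
      intro e he
      have h1 : e.1 ∈ R ∪ B := by exact_mod_cast (hE.sub e he).1
      have h2 : e.2 ∈ R ∪ B := by exact_mod_cast (hE.sub e he).2.1
      have hadj : G.Adj ⟨e.1, h1⟩ ⟨e.2, h2⟩ := Or.inl he
      exact ⟨fun ⟨_, h⟩ => ⟨h2, h.trans hadj.reachable⟩,
        fun ⟨_, h⟩ => ⟨h1, h.trans hadj.symm.reachable⟩⟩)
      u.1 (by exact_mod_cast u.2) v.1 (by exact_mod_cast v.2) ⟨u.2, SimpleGraph.Reachable.refl _⟩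
    exact this.2
  refine ⟨G, ⟨?_, ?_, ?_⟩, ?_⟩
  · rw [SimpleGraph.isTree_iff_connected_and_card]
    refine ⟨hGconn, le_antisymm ?_ hGconn.card_vert_le_card_edgeSet_add_one⟩
    have h1 : Nat.card G.edgeSet ≤ E.card := by
      let f : Sym2 {x : Pt // x ∈ R ∪ B} → Sym2 Pt := Sym2.map Subtype.val
      have hf : Function.Injective f := Sym2.map.injective Subtype.val_injective
      have h2 : f '' G.edgeSet ⊆ ↑(E.image (fun e => s(e.1, e.2))) := by
        rintro _ ⟨e, he, rfl⟩
        induction e using Sym2.ind with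
        | _ u v =>
          simp only [Finset.coe_image, Set.mem_image, Finset.mem_coe]
          rcases he with he | he
          · exact ⟨_, he, rfl⟩
          · exact ⟨_, he, Sym2.eq_swap⟩
      have h3 := Set.ncard_le_ncard h2 (Finset.finite_toSet _)
      rw [Set.ncard_image_of_injective _ hf, Set.ncard_coe_finset] at h3
      rw [Nat.card_coe_set_eq]
      exact h3.trans Finset.card_image_le
    have h2 := hE.card
    rw [Set.ncard_coe_finset] at h2
    have h3 : Nat.card {x : Pt // x ∈ R ∪ B} = (R ∪ B).card := by
      rw [Nat.card_eq_fintype_card, Fintype.card_coe]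
    omega
  · have key : ∀ u v : {x : Pt // x ∈ R ∪ B}, (u.1, v.1) ∈ E →
        ((u.1 ∈ R ∧ v.1 ∈ B) ∨ (u.1 ∈ B ∧ v.1 ∈ R)) := by
      intro u v h
      have h1 := (hE.sub _ h).2.2
      simp only at h1
      cases hu : col u.1 <;> cases hv : col v.1
      · rw [hu, hv] at h1; exact absurd rfl h1
      · exact Or.inr ⟨hcB _ u.2 hu, hcR _ hv⟩
      · exact Or.inl ⟨hcR _ hu, hcB _ v.2 hv⟩
      · rw [hu, hv] at h1; exact absurd rfl h1
    rintro u v (h | h)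
    · exact key u v h
    · have := key v u h; tauto
  · intro u v x y huv hxy hne z hz hz'
    have key : ∀ u v x y : {x : Pt // x ∈ R ∪ B}, s(u, v) ≠ s(x, y) →
        (u.1, v.1) ≠ (x.1, y.1) := by
      intro u v x y h h'
      simp only [Prod.mk.injEq] at h'
      exact h (by rw [Subtype.ext h'.1, Subtype.ext h'.2])
    have e1 : s(u, v) = s(v, u) := Sym2.eq_swap
    have e2 : s(x, y) = s(y, x) := Sym2.eq_swap
    rcases huv with h | h <;> rcases hxy with h' | h'
    · exact hE.plane _ h _ h' (key _ _ _ _ hne) z hz hz'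
    · have := hE.plane _ h _ h' (key _ _ _ _ (by rwa [← e2])) z hz
        (by rwa [segment_symm])
      simp only at this; tauto
    · have := hE.plane _ h _ h' (key _ _ _ _ (by rwa [← e1])) z (by rwa [segment_symm]) hz'
      simp only at this; tauto
    · have := hE.plane _ h _ h' (key _ _ _ _ (by rwa [← e1, ← e2])) z (by rwa [segment_symm])
        (by rwa [segment_symm])
      simp only at this; tauto
  · intro v
    refine le_trans ?_ (hdeg v.1)
    unfold deg dg
    have h2 : Subtype.val '' (G.neighborSet v) ⊆
        ↑((E.filter (fun e => e.1 = v.1 ∨ e.2 = v.1)).image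
          (fun e => if e.1 = v.1 then e.2 else e.1)) := by
      rintro _ ⟨u, hu, rfl⟩
      simp only [Finset.coe_image, Set.mem_image, Finset.mem_coe, Finset.mem_filter]
      rcases hu with hu | hu
      · exact ⟨_, ⟨hu, Or.inl rfl⟩, by simp⟩
      · refine ⟨_, ⟨hu, Or.inr rfl⟩, ?_⟩
        have : u.1 ≠ v.1 := fun h => (hE.sub _ hu).2.2 (by simp [h])
        simp [this]
    have h3 := Set.ncard_le_ncard h2 (Finset.finite_toSet _)
    rw [Set.ncard_image_of_injective _ Subtype.val_injective, Set.ncard_coe_finset] at h3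
    exact h3.trans Finset.card_image_le
end
end

section
/- Let R and B be two disjoint finite sets of points in the plane with R ∪ B in general position, and let k ≥ 2 be an integer with (k−1)|B| < |R| < k|B|. Then there exists a plane bichromatic tree on R ∪ B whose maximum vertex degree is at most max{5, k + 1}. -/
open scoped Classical

noncomputable section

namespace PBT

/-! ### Combinatorics of lists -/

lemma first_fail {α : Type*} (P : List α → Prop) (l : List α) (h0 : P []) (h1 : ¬ P l) :
    ∃ l1 q l2, l = l1 ++ q :: l2 ∧ P l1 ∧ ¬ P (l1 ++ [q]) := by
  induction l using List.reverseRecOn with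
  | nil => exact absurd h0 h1
  | append_singleton l x ih =>
    by_cases h : P l
    · exact ⟨l, x, [], rfl, h, h1⟩
    · obtain ⟨l1, q, l2, e, a, b⟩ := ih h
      exact ⟨l1, q, l2 ++ [x], by simp [e], a, b⟩

lemma last_true {α : Type*} (P : List α → Prop) (l : List α) (h0 : P []) (h1 : ¬ P l) :
    ∃ l1 q l2, l = l1 ++ q :: l2 ∧ P l1 ∧ ∀ t u, l2 = t ++ u → ¬ P (l1 ++ q :: t) := by
  induction l using List.reverseRecOn with
  | nil => exact absurd h0 h1
  | append_singleton l x ih =>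
    by_cases h : P l
    · refine ⟨l, x, [], rfl, h, ?_⟩
      intro t u e
      have : t = [] := by
        have := congrArg List.length e
        simp at this
        exact List.length_eq_zero_iff.mp (by omega)
      subst this
      exact h1
    · obtain ⟨l1, q, l2, e, a, b⟩ := ih h
      refine ⟨l1, q, l2 ++ [x], by simp [e], a, ?_⟩
      intro t u e2
      rcases List.eq_nil_or_concat u with hu | ⟨u', y, hu⟩
      · subst hu
        rw [List.append_nil] at e2
        subst e2
        rw [e] at h1
        simpa using h1
      · subst hu
        have e3 : l2 ++ [x] = (t ++ u') ++ [y] := by rw [e2]; simp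
        exact b t u' (List.append_inj_left' e3 rfl)

section Count
variable {α : Type*} (col : α → Bool)

/-- number of elements of a given colour -/
def cnt (b : Bool) (l : List α) : ℕ := (l.map col).count b

lemma cnt_nil (b : Bool) : cnt col b [] = 0 := rfl
lemma cnt_append (b : Bool) (l m : List α) : cnt col b (l ++ m) = cnt col b l + cnt col b m := by
  simp [cnt]
lemma cnt_cons_eq (b : Bool) (x : α) (l : List α) (h : col x = b) :
    cnt col b (x :: l) = cnt col b l + 1 := by
  simp [cnt, h]
lemma cnt_cons_ne (b : Bool) (x : α) (l : List α) (h : col x ≠ b) :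
    cnt col b (x :: l) = cnt col b l := by
  simp [cnt, h]
lemma cnt_perm (b : Bool) {l m : List α} (h : l.Perm m) : cnt col b l = cnt col b m := by
  unfold cnt
  exact (h.map col).count_eq b

/-- The numerical condition for hanging `l` on a root of colour `a` with capacity `c`. -/
def Cond (k : ℕ) (a : Bool) (c : ℕ) (l : List α) : Prop :=
  1 ≤ c ∧ c ≤ k ∧ cnt col a l + (if c = 1 then 1 else 0) ≤ k * cnt col (!a) l ∧
    cnt col (!a) l ≤ k * cnt col a l + c

lemma arith_half (k o1 s1 o2 s2 : ℤ) (hk : 4 ≤ k) (ho1 : 0 ≤ o1) (ho2 : 0 ≤ o2) (hs1 : 1 ≤ s1)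
    (hs2 : 1 ≤ s2)
    (h1 : o1 * (s1 + s2) ≤ s1 * (o1 + o2 + 1)) (h2 : s1 * (o1 + o2 + 1) ≤ (o1 + 1) * (s1 + s2))
    (hW : s1 + s2 + 1 ≤ k * (o1 + o2 + 1)) (hW' : o1 + o2 + 1 ≤ k * (s1 + s2) + 1) :
    o1 ≤ k * s1 ∧ s1 ≤ k * o1 + k - 1 ∧ (k * o1 + k - 1 ≤ s1 → o2 + 1 ≤ k * s2) := by
  refine ⟨?_, ?_, ?_⟩
  · by_contra hc
    push Not at hc
    have e1 : o1 * (o1 + o2) ≤ o1 * (k * (s1 + s2)) := mul_le_mul_of_nonneg_left (by linarith) ho1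
    have e2 : k * (o1 * (s1 + s2)) ≤ k * (s1 * (o1 + o2 + 1)) :=
      mul_le_mul_of_nonneg_left h1 (by linarith)
    have e3 : (k * s1 + 1) * (o1 + o2 + 1) ≤ o1 * (o1 + o2 + 1) :=
      mul_le_mul_of_nonneg_right (by linarith) (by linarith)
    nlinarith
  · by_contra hc
    push Not at hc
    have e1 : (k * o1 + k) * (o1 + o2 + 1) ≤ s1 * (o1 + o2 + 1) :=
      mul_le_mul_of_nonneg_right (by linarith) (by linarith)
    have e2 : (o1 + 1) * (s1 + s2 + 1) ≤ (o1 + 1) * (k * (o1 + o2 + 1)) :=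
      mul_le_mul_of_nonneg_left hW (by linarith)
    nlinarith
  · intro hs
    by_contra hc
    push Not at hc
    have hc' : k * s2 ≤ o2 := by linarith
    have h1' : o2 * (s1 + s2) ≤ s2 * (o1 + o2 + 1) := by nlinarith
    have e1 : k * s2 * (s1 + s2) ≤ o2 * (s1 + s2) :=
      mul_le_mul_of_nonneg_right hc' (by linarith)
    have e2 : k * (s1 + s2) ≤ o1 + o2 + 1 := by
      have : s2 * (k * (s1 + s2)) ≤ s2 * (o1 + o2 + 1) := by nlinarith
      exact le_of_mul_le_mul_left this (by linarith)
    have e3 : s1 * (k * (s1 + s2)) ≤ s1 * (o1 + o2 + 1) :=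
      mul_le_mul_of_nonneg_left e2 (by linarith)
    have e4 : k * s1 ≤ o1 + 1 := by
      have : (k * s1) * (s1 + s2) ≤ (o1 + 1) * (s1 + s2) := by nlinarith
      exact le_of_mul_le_mul_right this (by linarith)
    nlinarith

lemma arith_ab (k o1 s1 o2 s2 : ℤ) (hk : 4 ≤ k) (ho1 : 0 ≤ o1) (ho2 : 0 ≤ o2) (hs1 : 1 ≤ s1)
    (hs2 : 1 ≤ s2)
    (h1 : o1 * (s1 + s2) ≤ s1 * (o1 + o2 + 1)) (h2 : s1 * (o1 + o2 + 1) ≤ (o1 + 1) * (s1 + s2))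
    (hW : s1 + s2 + 1 ≤ k * (o1 + o2 + 1)) (hW' : o1 + o2 + 1 ≤ k * (s1 + s2) + 1) :
    ∃ a b : ℤ, 1 ≤ a ∧ 1 ≤ b ∧ a + b = k ∧ o1 + (if a = 1 then 1 else 0) ≤ k * s1 ∧
      s1 ≤ k * o1 + a ∧ o2 + (if b = 1 then 1 else 0) ≤ k * s2 ∧ s2 ≤ k * o2 + b := by
  obtain ⟨p1, p2, p3⟩ := arith_half k o1 s1 o2 s2 hk ho1 ho2 hs1 hs2 h1 h2 hW hW'
  obtain ⟨q1, q2, q3⟩ := arith_half k o2 s2 o1 s1 hk ho2 ho1 hs2 hs1 (by nlinarith)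
    (by nlinarith) (by linarith) (by linarith)
  have e : k * (o1 + o2 + 1) = k * o1 + k * o2 + k := by ring
  rw [e] at hW
  clear h1 h2 hW' e
  generalize k * o1 = A at *
  generalize k * o2 = B at *
  generalize k * s1 = C at *
  generalize k * s2 = E at *
  by_cases c1 : A + k - 1 ≤ s1
  · have := p3 c1
    refine ⟨k - 1, 1, ?_, ?_, ?_, ?_, ?_, ?_, ?_⟩ <;> (try split_ifs) <;> omega
  by_cases c2 : B + k - 1 ≤ s2
  · have := q3 c2
    refine ⟨1, k - 1, ?_, ?_, ?_, ?_, ?_, ?_, ?_⟩ <;> (try split_ifs) <;> omega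
  by_cases c3 : s1 - A ≤ 2
  · refine ⟨2, k - 2, ?_, ?_, ?_, ?_, ?_, ?_, ?_⟩ <;> (try split_ifs) <;> omega
  · refine ⟨s1 - A, k - (s1 - A), ?_, ?_, ?_, ?_, ?_, ?_, ?_⟩ <;> (try split_ifs) <;> omega

lemma comb_one (k : ℕ) (a : Bool) (l : List α) (c : ℕ) (hk : 4 ≤ k)
    (h : Cond col k a c l) (hbig : k * cnt col a l + 2 ≤ cnt col (!a) l) :
    ∃ l1 l2 c2, l = l1 ++ l2 ∧ l1 ≠ [] ∧ l2 ≠ [] ∧ 1 + c2 ≤ c ∧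
      Cond col k a 1 l1 ∧ Cond col k a c2 l2 := by
  obtain ⟨hc1, hck, h1, h2⟩ := h
  obtain ⟨l1, q, l2, e, hP, hnP⟩ := first_fail
    (fun m => cnt col (!a) m ≤ k * cnt col a m) l (by simp [cnt_nil]) (by omega)
  have hq : col q ≠ a := by
    intro hq
    apply hnP
    have hq' : col q ≠ !a := by rw [hq]; cases a <;> simp
    simp only [cnt_append, cnt_cons_eq col a q [] hq, cnt_cons_ne col (!a) q [] hq', cnt_nil]
    nlinarith
  have hq' : col q = !a := by revert hq; cases col q <;> cases a <;> simp
  have e1 : cnt col (!a) (l1 ++ [q]) = cnt col (!a) l1 + 1 := by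
    rw [cnt_append, cnt_cons_eq col _ q [] hq', cnt_nil]
  have e2 : cnt col a (l1 ++ [q]) = cnt col a l1 := by
    rw [cnt_append, cnt_cons_ne col _ q [] hq, cnt_nil, Nat.add_zero]
  have el : l = (l1 ++ [q]) ++ l2 := by simp [e]
  have f1 := cnt_append col a (l1 ++ [q]) l2
  have f2 := cnt_append col (!a) (l1 ++ [q]) l2
  rw [← el] at f1 f2
  rw [e1, e2] at hnP
  rw [e2] at f1
  rw [e1] at f2
  have ek : k * cnt col a l = k * cnt col a l1 + k * cnt col a l2 := by rw [f1]; ring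
  have g1 : 4 * cnt col a l1 ≤ k * cnt col a l1 := Nat.mul_le_mul_right _ hk
  have g2 : 4 * cnt col a l2 ≤ k * cnt col a l2 := Nat.mul_le_mul_right _ hk
  have g3 : 4 * cnt col (!a) l2 ≤ k * cnt col (!a) l2 := Nat.mul_le_mul_right _ hk
  have g4 : 4 * (cnt col (!a) l1 + 1) ≤ k * (cnt col (!a) l1 + 1) := Nat.mul_le_mul_right _ hk
  refine ⟨l1 ++ [q], l2, cnt col (!a) l2 - k * cnt col a l2, el, by simp, ?_, ?_, ?_, ?_⟩
  · rintro rfl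
    simp only [cnt_nil] at *
    omega
  · omega
  · refine ⟨le_refl _, by omega, ?_, ?_⟩
    · rw [e1, e2, if_pos rfl]; omega
    · rw [e1, e2]; omega
  · refine ⟨by omega, by omega, ?_, by omega⟩
    split_ifs <;> omega

lemma comb_two (k : ℕ) (a : Bool) (x y : α) (m : List α) (hk : 4 ≤ k)
    (hx : col x = a) (hy : col y = a)
    (h1 : cnt col a (x :: (m ++ [y])) + 1 ≤ k * cnt col (!a) (x :: (m ++ [y])))
    (h2 : cnt col (!a) (x :: (m ++ [y])) ≤ k * cnt col a (x :: (m ++ [y])) + 1) :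
    ∃ l1 q l2 c1 c2, x :: (m ++ [y]) = l1 ++ q :: l2 ∧ col q = !a ∧ c1 + c2 = k ∧
      Cond col k (!a) c1 l1 ∧ Cond col k (!a) c2 l2 := by
  have hx' : col x ≠ !a := by rw [hx]; cases a <;> simp
  have hy' : col y ≠ !a := by rw [hy]; cases a <;> simp
  have es : cnt col a (x :: (m ++ [y])) = cnt col a m + 2 := by
    rw [cnt_cons_eq col _ _ _ hx, cnt_append, cnt_cons_eq col _ _ _ hy, cnt_nil]
  have eo : cnt col (!a) (x :: (m ++ [y])) = cnt col (!a) m := by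
    rw [cnt_cons_ne col _ _ _ hx', cnt_append, cnt_cons_ne col _ _ _ hy', cnt_nil]; rfl
  rw [es, eo] at h1 h2
  have ho : 1 ≤ cnt col (!a) m := by
    by_contra hc
    have : cnt col (!a) m = 0 := by omega
    rw [this] at h1
    omega
  obtain ⟨m1, q, m2, e, hP, hnP⟩ := first_fail
    (fun m' => cnt col (!a) m' * (cnt col a m + 2) ≤ (cnt col a m' + 1) * cnt col (!a) m) m
    (by simp [cnt_nil]) (by intro hc; nlinarith)
  have hq : col q ≠ a := by
    intro hq
    apply hnP
    have hq' : col q ≠ !a := by rw [hq]; cases a <;> simp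
    simp only [cnt_append, cnt_cons_eq col a q [] hq, cnt_cons_ne col (!a) q [] hq', cnt_nil]
    nlinarith
  have hq' : col q = !a := by revert hq; cases col q <;> cases a <;> simp
  have e1 : cnt col (!a) (m1 ++ [q]) = cnt col (!a) m1 + 1 := by
    rw [cnt_append, cnt_cons_eq col _ q [] hq', cnt_nil]
  have e2 : cnt col a (m1 ++ [q]) = cnt col a m1 := by
    rw [cnt_append, cnt_cons_ne col _ q [] hq, cnt_nil, Nat.add_zero]
  rw [e1, e2] at hnP
  have f1 : cnt col (!a) m = cnt col (!a) m1 + cnt col (!a) m2 + 1 := by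
    rw [e, cnt_append, cnt_cons_eq col _ q _ hq']; ring
  have f2 : cnt col a m = cnt col a m1 + cnt col a m2 := by
    rw [e, cnt_append, cnt_cons_ne col _ q _ hq]
  rw [f1, f2] at hP hnP h1 h2
  have t1 : cnt col a (x :: m1) = cnt col a m1 + 1 := cnt_cons_eq col _ _ _ hx
  have t2 : cnt col (!a) (x :: m1) = cnt col (!a) m1 := cnt_cons_ne col _ _ _ hx'
  have t3 : cnt col a (m2 ++ [y]) = cnt col a m2 + 1 := by
    rw [cnt_append, cnt_cons_eq col _ _ _ hy, cnt_nil]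
  have t4 : cnt col (!a) (m2 ++ [y]) = cnt col (!a) m2 := by
    rw [cnt_append, cnt_cons_ne col _ _ _ hy', cnt_nil]; rfl
  generalize cnt col a m1 = s1 at *
  generalize cnt col a m2 = s2 at *
  generalize cnt col (!a) m1 = o1 at *
  generalize cnt col (!a) m2 = o2 at *
  push Not at hnP
  zify at hP hnP h1 h2
  obtain ⟨c1, c2, q1, q2, q3, q4, q5, q6, q7⟩ := arith_ab k o1 (s1 + 1) o2 (s2 + 1)
    (by exact_mod_cast hk) (by positivity) (by positivity) (by simp) (by simp)
    (by linarith) (by linarith) (by linarith) (by linarith)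
  lift c1 to ℕ using by omega
  lift c2 to ℕ using by omega
  refine ⟨x :: m1, q, m2 ++ [y], c1, c2, by simp [e], hq', by omega, ?_, ?_⟩
  · refine ⟨by omega, by omega, ?_, ?_⟩
    · rw [Bool.not_not, t1, t2]; zify; split_ifs at q4 ⊢ <;> omega
    · rw [Bool.not_not, t1, t2]; zify; linarith
  · refine ⟨by omega, by omega, ?_, ?_⟩
    · rw [Bool.not_not, t3, t4]; zify; split_ifs at q6 ⊢ <;> omega
    · rw [Bool.not_not, t3, t4]; zify; linarith

lemma comb_three (k : ℕ) (a : Bool) (x : α) (m : List α) (hk : 4 ≤ k)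
    (hx : col x = a) (h1 : cnt col a (x :: m) = k * cnt col (!a) (x :: m)) :
    ∃ l1 q l2, x :: m = l1 ++ q :: l2 ∧ col q = !a ∧
      ((∃ c1 c2, c1 + c2 = k ∧ Cond col k (!a) c1 l1 ∧ Cond col k (!a) c2 l2) ∨
       (Cond col k (!a) k l1 ∧ (l2 = [] ∨ ∃ q' l3, l2 = q' :: l3 ∧ col q' = !a ∧
        Cond col k (!a) k l3))) := by
  have hx' : col x ≠ !a := by rw [hx]; cases a <;> simp
  rw [cnt_cons_eq col _ _ _ hx, cnt_cons_ne col _ _ _ hx'] at h1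
  obtain ⟨m1, q, m2, e, hP, hnP⟩ := last_true
    (fun m' => k * cnt col (!a) m' < cnt col a m' + 1) m
    (by simp [cnt_nil]) (by omega)
  have hn0 := hnP [] m2 rfl
  have hq : col q ≠ a := by
    intro hq
    apply hn0
    have hq' : col q ≠ !a := by rw [hq]; cases a <;> simp
    simp only [cnt_append, cnt_cons_eq col a q [] hq, cnt_cons_ne col (!a) q [] hq', cnt_nil,
      Nat.add_zero]
    omega
  have hq' : col q = !a := by revert hq; cases col q <;> cases a <;> simp
  have e1 : cnt col (!a) (m1 ++ [q]) = cnt col (!a) m1 + 1 := by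
    rw [cnt_append, cnt_cons_eq col _ q [] hq', cnt_nil]
  have e2 : cnt col a (m1 ++ [q]) = cnt col a m1 := by
    rw [cnt_append, cnt_cons_ne col _ q [] hq, cnt_nil, Nat.add_zero]
  rw [e1, e2] at hn0
  have f1 : cnt col (!a) m = cnt col (!a) m1 + cnt col (!a) m2 + 1 := by
    rw [e, cnt_append, cnt_cons_eq col _ q _ hq']; ring
  have f2 : cnt col a m = cnt col a m1 + cnt col a m2 := by
    rw [e, cnt_append, cnt_cons_ne col _ q _ hq]
  rw [f1, f2] at h1
  have t1 : cnt col a (x :: m1) = cnt col a m1 + 1 := cnt_cons_eq col _ _ _ hx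
  have t2 : cnt col (!a) (x :: m1) = cnt col (!a) m1 := cnt_cons_ne col _ _ _ hx'
  have d1 : k * (cnt col (!a) m1 + cnt col (!a) m2 + 1) =
    k * cnt col (!a) m1 + k * cnt col (!a) m2 + k := by ring
  have d2 : k * (cnt col (!a) m1 + 1) = k * cnt col (!a) m1 + k := by ring
  have d3 : k * (cnt col a m1 + 1) = k * cnt col a m1 + k := by ring
  have g1 : 4 * cnt col a m1 ≤ k * cnt col a m1 := Nat.mul_le_mul_right _ hk
  have g2 : 4 * cnt col a m2 ≤ k * cnt col a m2 := Nat.mul_le_mul_right _ hk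
  have g3 : 4 * cnt col (!a) m2 ≤ k * cnt col (!a) m2 := Nat.mul_le_mul_right _ hk
  have g4 : 4 * cnt col (!a) m1 ≤ k * cnt col (!a) m1 := Nat.mul_le_mul_right _ hk
  refine ⟨x :: m1, q, m2, by simp [e], hq', ?_⟩
  by_cases hα : cnt col a m1 + 1 < k * cnt col (!a) m1 + k
  · left
    refine ⟨cnt col a m1 + 1 - k * cnt col (!a) m1, k - (cnt col a m1 + 1 - k * cnt col (!a) m1),
      by omega, ⟨by omega, by omega, ?_, ?_⟩, ⟨by omega, by omega, ?_, ?_⟩⟩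
    · rw [Bool.not_not, t1, t2, d3]; split_ifs <;> omega
    · rw [Bool.not_not, t1, t2]; omega
    · rw [Bool.not_not]; split_ifs <;> omega
    · rw [Bool.not_not]; omega
  · right
    refine ⟨⟨by omega, by omega, ?_, ?_⟩, ?_⟩
    · rw [Bool.not_not, t1, t2, d3]; split_ifs <;> omega
    · rw [Bool.not_not, t1, t2]; omega
    · rcases m2 with _ | ⟨q', l3⟩
      · left; rfl
      · right
        have hn1 := hnP [q'] l3 rfl
        have hr : col q' ≠ a := by
          intro hr
          apply hn1
          have hr' : col q' ≠ !a := by rw [hr]; cases a <;> simp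
          have z1 : cnt col a (m1 ++ [q, q']) = cnt col a m1 + 1 := by
            rw [cnt_append, cnt_cons_ne col _ _ _ hq, cnt_cons_eq col _ _ _ hr, cnt_nil]
          have z2 : cnt col (!a) (m1 ++ [q, q']) = cnt col (!a) m1 + 1 := by
            rw [cnt_append, cnt_cons_eq col _ _ _ hq', cnt_cons_ne col _ _ _ hr', cnt_nil]
          rw [z1, z2]
          omega
        have hr' : col q' = !a := by revert hr; cases col q' <;> cases a <;> simp
        have z1 := cnt_cons_eq col _ _ l3 hr'
        have z2 := cnt_cons_ne col _ _ l3 hr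
        have d4 : k * cnt col (!a) (q' :: l3) = k * cnt col (!a) l3 + k := by rw [z1]; ring
        have g5 : 4 * cnt col a l3 ≤ k * cnt col a l3 := Nat.mul_le_mul_right _ hk
        have g6 : 4 * cnt col (!a) l3 ≤ k * cnt col (!a) l3 := Nat.mul_le_mul_right _ hk
        refine ⟨q', l3, rfl, hr', ⟨by omega, by omega, ?_, ?_⟩⟩
        · rw [Bool.not_not]; split_ifs <;> omega
        · rw [Bool.not_not]; omega

end Count

end PBT

namespace PBT

/-! ### Geometry -/

/-- The cross product. -/
def cr (u v : Pt) : ℝ := u.1 * v.2 - u.2 * v.1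

lemma collinear_of_cr (p x y : Pt) (hx : x ≠ p) (h : cr (x - p) (y - p) = 0) :
    Collinear ℝ ({p, x, y} : Set Pt) := by
  rw [collinear_iff_of_mem (p₀ := p) (by simp)]
  have key : ∃ r : ℝ, y = r • (x - p) +ᵥ p := by
    simp only [cr, Prod.fst_sub, Prod.snd_sub] at h
    by_cases h1 : x.1 - p.1 = 0
    · have h2 : x.2 - p.2 ≠ 0 := by
        intro h2
        exact hx (Prod.ext (by linarith) (by linarith))
      refine ⟨(y.2 - p.2) / (x.2 - p.2), ?_⟩
      have h3 : y.1 - p.1 = 0 := by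
        rw [h1] at h
        have : (x.2 - p.2) * (y.1 - p.1) = 0 := by linarith
        exact (mul_eq_zero.mp this).resolve_left h2
      ext
      · simp [h1]; linarith
      · simp; field_simp; ring
    · refine ⟨(y.1 - p.1) / (x.1 - p.1), ?_⟩
      ext
      · simp; field_simp; ring
      · simp; field_simp; linarith
  obtain ⟨r, hr⟩ := key
  refine ⟨x - p, ?_⟩
  intro z hz
  simp only [Set.mem_insert_iff, Set.mem_singleton_iff] at hz
  rcases hz with rfl | rfl | rfl
  · exact ⟨0, by simp⟩
  · exact ⟨1, by simp⟩
  · exact ⟨r, hr⟩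

lemma cr_ne (V : Set Pt) (h : GenPos V) (p x y : Pt) (hp : p ∈ V) (hx : x ∈ V) (hy : y ∈ V)
    (h1 : x ≠ p) (h2 : y ≠ p) (h3 : x ≠ y) : cr (x - p) (y - p) ≠ 0 := fun h0 =>
  h p hp x hx y hy h1.symm h2.symm h3 (collinear_of_cr p x y h1 h0)

lemma cr_id (d x y : Pt) : cr x y * (d.1 ^ 2 + d.2 ^ 2) =
    (d.1 * x.1 + d.2 * x.2) * cr d y - cr d x * (d.1 * y.1 + d.2 * y.2) := by
  simp only [cr]; ring

lemma sort_around (l : List Pt) (p d : Pt) (hn : l.Nodup) (hg : GenPos {x | x ∈ p :: l})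
    (hd : ∀ x ∈ l, 0 < cr d (x - p)) :
    ∃ l' : List Pt, l'.Perm l ∧ l'.Pairwise (fun x y => 0 < cr (x - p) (y - p)) := by
  let key : Pt → ℝ := fun x => (d.1 * (x - p).1 + d.2 * (x - p).2) / cr d (x - p)
  let r : Pt → Pt → Prop := fun x y => key y ≤ key x
  have : Std.Total r := ⟨fun x y => le_total _ _⟩
  have : IsTrans Pt r := ⟨fun x y z h1 h2 => le_trans h2 h1⟩
  refine ⟨l.insertionSort r, List.perm_insertionSort r l, ?_⟩
  have hs := List.pairwise_insertionSort r l
  have hperm := List.perm_insertionSort r l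
  have hn' : (l.insertionSort r).Nodup := hperm.nodup_iff.mpr hn
  refine (hs.and hn').imp_of_mem ?_
  intro x y hx hy ⟨hxy, hne⟩
  have hx' := hperm.mem_iff.mp hx
  have hy' := hperm.mem_iff.mp hy
  have px := hd x hx'
  have py := hd y hy'
  have nx : x ≠ p := by rintro rfl; simp [cr] at px
  have ny : y ≠ p := by rintro rfl; simp [cr] at py
  have h0 := cr_ne _ hg p x y (by simp) (by simp [hx']) (by simp [hy']) nx ny hne
  have hxy' : (d.1 * (y - p).1 + d.2 * (y - p).2) / cr d (y - p) ≤
      (d.1 * (x - p).1 + d.2 * (x - p).2) / cr d (x - p) := hxy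
  rw [div_le_div_iff₀ py px] at hxy'
  have hid := cr_id d (x - p) (y - p)
  have hpos : 0 < d.1 ^ 2 + d.2 ^ 2 := by
    by_contra hc
    have e1 : d.1 = 0 := by nlinarith [sq_nonneg d.1, sq_nonneg d.2]
    have e2 : d.2 = 0 := by nlinarith [sq_nonneg d.1, sq_nonneg d.2]
    simp [cr, e1, e2] at px
  rcases lt_or_gt_of_ne h0 with h | h
  · have := mul_neg_of_neg_of_pos h hpos
    nlinarith
  · exact h

/-- A connected plane bichromatic graph on `V`. -/
structure PG (col : Pt → Bool) (V : Set Pt) (G : SimpleGraph Pt) : Prop where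
  mem : ∀ u v, G.Adj u v → u ∈ V
  bi : ∀ u v, G.Adj u v → col u ≠ col v
  conn : ∀ x ∈ V, ∀ y ∈ V, G.Reachable x y
  plane : ∀ u v x y, G.Adj u v → G.Adj x y → s(u, v) ≠ s(x, y) →
      ∀ p : Pt, p ∈ segment ℝ u v → p ∈ segment ℝ x y →
        (p = u ∨ p = v) ∧ (p = x ∨ p = y)

lemma endpoint_of (V : Set Pt) (hg : GenPos V) (q u v : Pt) (hq : q ∈ V) (hu : u ∈ V) (hv : v ∈ V)
    (huv : u ≠ v) (h : q ∈ segment ℝ u v) : q = u ∨ q = v := by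
  by_contra hc
  push Not at hc
  rw [mem_segment_iff_wbtw] at h
  exact hg u hu q hq v hv hc.1.symm huv hc.2 h.collinear

lemma cr_seg (n q u v : Pt) (a b : ℝ) (hab : a + b = 1) :
    cr n (a • u + b • v - q) = a * cr n (u - q) + b * cr n (v - q) := by
  have : a = 1 - b := by linarith
  subst this
  simp [cr]; ring

lemma glue_pt (V : Set Pt) (hg : GenPos V) (n q u v x y z : Pt)
    (hq : q ∈ V) (hu : u ∈ V) (hv : v ∈ V) (huv : u ≠ v) (hxy : x ≠ y)
    (hu0 : 0 ≤ cr n (u - q)) (hv0 : 0 ≤ cr n (v - q))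
    (hx0 : x ≠ q → cr n (x - q) < 0) (hy0 : y ≠ q → cr n (y - q) < 0)
    (h1 : z ∈ segment ℝ u v) (h2 : z ∈ segment ℝ x y) :
    (z = u ∨ z = v) ∧ (z = x ∨ z = y) := by
  have hz0 : 0 ≤ cr n (z - q) := by
    obtain ⟨a, b, ha, hb, hab, rfl⟩ := h1
    rw [cr_seg n q u v a b hab]
    positivity
  have hz : z = q ∧ (z = x ∨ z = y) := by
    obtain ⟨a, b, ha, hb, hab, rfl⟩ := h2
    rw [cr_seg n q x y a b hab] at hz0
    by_cases hx : x = q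
    · have hy := hy0 (by rw [← hx]; exact hxy.symm)
      have hx1 : cr n (x - q) = 0 := by rw [hx]; simp [cr]
      rw [hx1] at hz0
      have hb0 : b = 0 := by
        by_contra hb0
        have : 0 < b := lt_of_le_of_ne hb (Ne.symm hb0)
        nlinarith
      have ha1 : a = 1 := by linarith
      subst hb0 ha1
      simp [hx]
    · have hx2 := hx0 hx
      by_cases hy : y = q
      · have hy1 : cr n (y - q) = 0 := by rw [hy]; simp [cr]
        rw [hy1] at hz0
        have ha0 : a = 0 := by
          by_contra ha0
          have : 0 < a := lt_of_le_of_ne ha (Ne.symm ha0)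
          nlinarith
        have hb1 : b = 1 := by linarith
        subst ha0 hb1
        simp [hy]
      · have hy2 := hy0 hy
        exfalso
        have hb' : b = 1 - a := by linarith
        subst hb'
        rcases ha.eq_or_lt with h | h
        · rw [← h] at hz0; linarith
        · nlinarith
  obtain ⟨hzq, hz2⟩ := hz
  refine ⟨?_, hz2⟩
  rw [hzq] at h1 ⊢
  exact endpoint_of V hg q u v hq hu hv huv h1

lemma glue (col : Pt → Bool) (V1 V2 V : Set Pt) (hV : ∀ x, x ∈ V ↔ x ∈ V1 ∨ x ∈ V2)
    (hg : GenPos V) (n q : Pt)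
    (hq1 : q ∈ V1) (hq2 : q ∈ V2) (h1 : ∀ x ∈ V1, 0 ≤ cr n (x - q))
    (h2 : ∀ x ∈ V2, x ≠ q → cr n (x - q) < 0) (G1 G2 : SimpleGraph Pt)
    (H1 : PG col V1 G1) (H2 : PG col V2 G2) : PG col V (G1 ⊔ G2) := by
  refine ⟨?_, ?_, ?_, ?_⟩
  · rintro u v (h | h)
    · exact (hV u).2 (Or.inl (H1.mem u v h))
    · exact (hV u).2 (Or.inr (H2.mem u v h))
  · rintro u v (h | h)
    · exact H1.bi u v h
    · exact H2.bi u v h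
  · have key : ∀ x ∈ V, (G1 ⊔ G2).Reachable q x := by
      intro x hx
      rcases (hV x).1 hx with h | h
      · exact (H1.conn q hq1 x h).mono le_sup_left
      · exact (H2.conn q hq2 x h).mono le_sup_right
    intro x hx y hy
    exact (key x hx).symm.trans (key y hy)
  · rintro u v x y (h | h) (h' | h') hne z hz hz'
    · exact H1.plane u v x y h h' hne z hz hz'
    · have hu := H1.mem u v h
      have hv := H1.mem v u h.symm
      exact glue_pt V hg n q u v x y z ((hV q).2 (Or.inl hq1)) ((hV u).2 (Or.inl hu))
        ((hV v).2 (Or.inl hv)) h.ne h'.ne (h1 u hu) (h1 v hv) (h2 x (H2.mem x y h'))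
        (h2 y (H2.mem y x h'.symm)) hz hz'
    · have hu := H1.mem x y h'
      have hv := H1.mem y x h'.symm
      exact (glue_pt V hg n q x y u v z ((hV q).2 (Or.inl hq1)) ((hV x).2 (Or.inl hu))
        ((hV y).2 (Or.inl hv)) h'.ne h.ne (h1 x hu) (h1 y hv) (h2 u (H2.mem u v h))
        (h2 v (H2.mem v u h.symm)) hz' hz).symm
    · exact H2.plane u v x y h h' hne z hz hz'

lemma deg_sup (G1 G2 : SimpleGraph Pt) (v : Pt) : deg (G1 ⊔ G2) v ≤ deg G1 v + deg G2 v := by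
  have : (G1 ⊔ G2).neighborSet v = G1.neighborSet v ∪ G2.neighborSet v := by
    ext x; simp
  unfold deg
  rw [this]
  exact Set.ncard_union_le _ _

lemma deg_zero {col : Pt → Bool} {V : Set Pt} {G : SimpleGraph Pt} (H : PG col V G) (v : Pt)
    (hv : v ∉ V) : deg G v = 0 := by
  have : G.neighborSet v = ∅ := by
    ext x
    simp only [SimpleGraph.mem_neighborSet, Set.mem_empty_iff_false, iff_false]
    intro h
    exact hv (H.mem v x h)
  unfold deg
  rw [this, Set.ncard_empty]

/-- There is a solution with root `p` of capacity `c`. -/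
def Sol (col : Pt → Bool) (k : ℕ) (p : Pt) (c : ℕ) (l : List Pt) : Prop :=
  ∃ G, PG col {x | x ∈ p :: l} G ∧ deg G p ≤ c ∧ ∀ v, v ≠ p → deg G v ≤ k + 1

lemma Sol.mono {col : Pt → Bool} {k : ℕ} {p : Pt} {c c' : ℕ} {l : List Pt}
    (h : Sol col k p c l) (hc : c ≤ c') : Sol col k p c' l := by
  obtain ⟨G, h1, h2, h3⟩ := h
  exact ⟨G, h1, h2.trans hc, h3⟩

lemma sol_nil (col : Pt → Bool) (k : ℕ) (p : Pt) (c : ℕ) : Sol col k p c [] := by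
  have hd : ∀ v, deg (⊥ : SimpleGraph Pt) v = 0 := by
    intro v
    have : (⊥ : SimpleGraph Pt).neighborSet v = ∅ := by ext x; simp
    unfold deg
    rw [this, Set.ncard_empty]
  refine ⟨⊥, ⟨?_, ?_, ?_, ?_⟩, by simp [hd], by simp [hd]⟩
  · intro u v h; exact absurd h (by simp)
  · intro u v h; exact absurd h (by simp)
  · intro x hx y hy
    simp at hx hy
    subst hx hy
    exact SimpleGraph.Reachable.refl _
  · intro u v x y h; exact absurd h (by simp)

lemma edge_adj (p q u v : Pt) (h : (SimpleGraph.fromEdgeSet {s(p, q)}).Adj u v) :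
    (u = p ∧ v = q) ∨ (u = q ∧ v = p) := by
  rw [SimpleGraph.fromEdgeSet_adj] at h
  simpa using h.1

lemma edge_PG (col : Pt → Bool) (p q : Pt) (h : col q ≠ col p) :
    PG col {x | x = p ∨ x = q} (SimpleGraph.fromEdgeSet {s(p, q)}) := by
  have hpq : p ≠ q := by rintro rfl; exact h rfl
  have hadj : (SimpleGraph.fromEdgeSet {s(p, q)}).Adj p q := by
    rw [SimpleGraph.fromEdgeSet_adj]; exact ⟨rfl, hpq⟩
  refine ⟨?_, ?_, ?_, ?_⟩
  · intro u v huv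
    rcases edge_adj p q u v huv with ⟨rfl, rfl⟩ | ⟨rfl, rfl⟩ <;> simp
  · intro u v huv
    rcases edge_adj p q u v huv with ⟨rfl, rfl⟩ | ⟨rfl, rfl⟩
    · exact h.symm
    · exact h
  · intro x hx y hy
    rcases hx with rfl | rfl <;> rcases hy with rfl | rfl
    · exact SimpleGraph.Reachable.refl _
    · exact hadj.reachable
    · exact hadj.symm.reachable
    · exact SimpleGraph.Reachable.refl _
  · intro u v x y h1 h2 hne
    exfalso
    apply hne
    rcases edge_adj p q u v h1 with ⟨rfl, rfl⟩ | ⟨rfl, rfl⟩ <;>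
      rcases edge_adj _ _ x y h2 with ⟨rfl, rfl⟩ | ⟨rfl, rfl⟩ <;> simp [Sym2.eq_swap]

lemma edge_deg (p q v : Pt) : deg (SimpleGraph.fromEdgeSet {s(p, q)}) v ≤ 1 := by
  unfold deg
  have hsub : (SimpleGraph.fromEdgeSet {s(p, q)}).neighborSet v ⊆ {if v = p then q else p} := by
    intro x hx
    rw [SimpleGraph.mem_neighborSet] at hx
    have hne := hx.ne
    rw [Set.mem_singleton_iff]
    rcases edge_adj p q v x hx with ⟨h1, h2⟩ | ⟨h1, h2⟩
    · rw [if_pos h1, h2]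
    · rw [if_neg (by rw [← h2]; exact hne), h2]
  have := Set.ncard_le_ncard hsub (Set.finite_singleton _)
  rwa [Set.ncard_singleton] at this

lemma op_one (col : Pt → Bool) (k : ℕ) (p n : Pt) (l1 l2 : List Pt) (c1 c2 : ℕ)
    (hg : GenPos {x | x ∈ p :: (l1 ++ l2)})
    (h1 : ∀ x ∈ l1, 0 < cr n (x - p)) (h2 : ∀ x ∈ l2, cr n (x - p) < 0)
    (S1 : Sol col k p c1 l1) (S2 : Sol col k p c2 l2) : Sol col k p (c1 + c2) (l1 ++ l2) := by
  obtain ⟨G1, H1, d1, e1⟩ := S1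
  obtain ⟨G2, H2, d2, e2⟩ := S2
  refine ⟨G1 ⊔ G2, ?_, ?_, ?_⟩
  · refine glue col _ _ _ ?_ hg n p (by simp) (by simp) ?_ ?_ G1 G2 H1 H2
    · intro x; simp; tauto
    · intro x hx
      simp at hx
      rcases hx with rfl | hx
      · simp [cr]
      · exact (h1 x hx).le
    · intro x hx hne
      simp at hx
      exact h2 x (hx.resolve_left hne)
  · exact (deg_sup G1 G2 p).trans (by omega)
  · intro v hv
    have hs := deg_sup G1 G2 v
    by_cases hv1 : v ∈ l1
    · have : deg G2 v = 0 := deg_zero H2 v (by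
        intro hc
        simp at hc
        have hc' := hc.resolve_left hv
        linarith [h1 v hv1, h2 v hc'])
      have := e1 v hv
      omega
    · have : deg G1 v = 0 := deg_zero H1 v (by simp [hv, hv1])
      have := e2 v hv
      omega

lemma op_two (col : Pt → Bool) (k : ℕ) (p q : Pt) (l1 l2 : List Pt) (c1 c2 : ℕ)
    (hg : GenPos {x | x ∈ p :: (l1 ++ q :: l2)}) (hcol : col q ≠ col p)
    (h1 : ∀ x ∈ l1, 0 < cr (x - p) (q - p)) (h2 : ∀ x ∈ l2, 0 < cr (q - p) (x - p))
    (hc : c1 + c2 ≤ k)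
    (S1 : Sol col k q c1 l1) (S2 : Sol col k q c2 l2) : Sol col k p 1 (l1 ++ q :: l2) := by
  have hpq : p ≠ q := by rintro rfl; exact hcol rfl
  have h1' : ∀ x ∈ l1, cr (q - p) (x - q) < 0 := by
    intro x hx
    have := h1 x hx
    simp only [cr, Prod.fst_sub, Prod.snd_sub] at this ⊢
    linarith
  have h2' : ∀ x ∈ l2, 0 < cr (q - p) (x - q) := by
    intro x hx
    have := h2 x hx
    simp only [cr, Prod.fst_sub, Prod.snd_sub] at this ⊢
    linarith
  have hp0 : cr (q - p) (p - q) = 0 := by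
    simp only [cr, Prod.fst_sub, Prod.snd_sub]; ring
  have hp1 : p ∉ l1 := fun h => by have := h1' p h; linarith
  have hp2 : p ∉ l2 := fun h => by have := h2' p h; linarith
  obtain ⟨G1, H1, d1, e1⟩ := S1
  obtain ⟨G2, H2, d2, e2⟩ := S2
  have H0 := edge_PG col p q hcol
  have HA : PG col {x | x ∈ p :: q :: l2} (SimpleGraph.fromEdgeSet {s(p, q)} ⊔ G2) := by
    refine glue col _ _ _ ?_ ?_ (p - q) q (by simp) (by simp) ?_ ?_ _ _ H0 H2
    · intro x; simp; tauto
    · intro a ha b hb c hc'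
      refine hg a ?_ b ?_ c ?_
      · simp at ha ⊢; tauto
      · simp at hb ⊢; tauto
      · simp at hc' ⊢; tauto
    · rintro x (rfl | rfl)
      · simp only [cr, Prod.fst_sub, Prod.snd_sub]; apply le_of_eq; ring
      · simp [cr]
    · intro x hx hne
      simp at hx
      have := h2' x (hx.resolve_left hne)
      simp only [cr, Prod.fst_sub, Prod.snd_sub] at this ⊢
      linarith
  refine ⟨(SimpleGraph.fromEdgeSet {s(p, q)} ⊔ G2) ⊔ G1, ?_, ?_, ?_⟩
  · refine glue col _ _ _ ?_ hg (q - p) q (by simp) (by simp) ?_ ?_ _ _ HA H1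
    · intro x; simp; tauto
    · intro x hx
      simp at hx
      rcases hx with rfl | rfl | hx
      · rw [hp0]
      · simp [cr]
      · exact (h2' x hx).le
    · intro x hx hne
      simp at hx
      exact h1' x (hx.resolve_left hne)
  · have s1 := deg_sup (SimpleGraph.fromEdgeSet {s(p, q)} ⊔ G2) G1 p
    have s2 := deg_sup (SimpleGraph.fromEdgeSet {s(p, q)}) G2 p
    have s3 := edge_deg p q p
    have s4 := deg_zero H1 p (by simp [hpq, hp1])
    have s5 := deg_zero H2 p (by simp [hpq, hp2])
    omega
  · intro v hv
    have s1 := deg_sup (SimpleGraph.fromEdgeSet {s(p, q)} ⊔ G2) G1 v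
    have s2 := deg_sup (SimpleGraph.fromEdgeSet {s(p, q)}) G2 v
    by_cases hvq : v = q
    · subst hvq
      have s3 := edge_deg p v v
      omega
    · have s3 := deg_zero H0 v (by simp [hv, hvq])
      have s6 := e1 v hvq
      have s7 := e2 v hvq
      by_cases hv1 : v ∈ l1
      · have : deg G2 v = 0 := deg_zero H2 v (by
          intro hc
          simp at hc
          have hc' := hc.resolve_left hvq
          linarith [h1' v hv1, h2' v hc'])
        omega
      · have : deg G1 v = 0 := deg_zero H1 v (by simp [hvq, hv1])
        omega

lemma sep_dir (p : Pt) (l1 l2 : List Pt) (hn1 : l1 ≠ []) (hn2 : l2 ≠ [])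
    (hs : (l1 ++ l2).Pairwise (fun x y => 0 < cr (x - p) (y - p))) :
    ∃ n, (∀ x ∈ l1, 0 < cr n (x - p)) ∧ (∀ x ∈ l2, cr n (x - p) < 0) := by
  obtain ⟨m, a, rfl⟩ := (List.eq_nil_or_concat l1).resolve_left hn1
  obtain ⟨b, t, rfl⟩ := List.exists_cons_of_ne_nil hn2
  rw [List.concat_eq_append] at *
  rw [List.pairwise_append] at hs
  obtain ⟨hA, hB, hAB⟩ := hs
  rw [List.pairwise_append] at hA
  rw [List.pairwise_cons] at hB
  have hab := hAB a (by simp) b (by simp)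
  refine ⟨-((a - p) + (b - p)), ?_, ?_⟩
  · intro x hx
    have h1 := hAB x hx b (by simp)
    have h2 : 0 ≤ cr (x - p) (a - p) := by
      simp at hx
      rcases hx with hx | rfl
      · exact (hA.2.2 x hx a (by simp)).le
      · apply le_of_eq; simp only [cr]; ring
    simp only [cr, Prod.fst_sub, Prod.snd_sub, Prod.fst_neg, Prod.snd_neg, Prod.fst_add,
      Prod.snd_add] at *
    linarith
  · intro x hx
    have h1 := hAB a (by simp) x hx
    have h2 : 0 ≤ cr (b - p) (x - p) := by
      simp at hx
      rcases hx with rfl | hx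
      · apply le_of_eq; simp only [cr]; ring
      · exact (hB.1 x hx).le
    simp only [cr, Prod.fst_sub, Prod.snd_sub, Prod.fst_neg, Prod.snd_neg, Prod.fst_add,
      Prod.snd_add] at *
    linarith

lemma GenPos.sub {V W : Set Pt} (h : GenPos V) (hW : W ⊆ V) : GenPos W :=
  fun p hp q hq r hr => h p (hW hp) q (hW hq) r (hW hr)

theorem main (col : Pt → Bool) (k : ℕ) (hk : 4 ≤ k) : ∀ N : ℕ, ∀ l : List Pt, l.length < N →
    ∀ p d c, l.Nodup → GenPos {x | x ∈ p :: l} → (∀ x ∈ l, 0 < cr d (x - p)) →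
    Cond col k (col p) c l → Sol col k p c l := by
  intro N
  induction N with
  | zero => intro l hl; omega
  | succ N ih =>
  intro l0 hlen p d c hnod0 hgp0 hd0 hcond0
  obtain ⟨l, hperm, hsort⟩ := sort_around l0 p d hnod0 hgp0 hd0
  have hset : ({x | x ∈ p :: l0} : Set Pt) = {x | x ∈ p :: l} := by
    ext x; simp [hperm.mem_iff]
  have hnod : l.Nodup := hperm.nodup_iff.mpr hnod0
  have hcond : Cond col k (col p) c l := by
    unfold Cond at *
    rw [cnt_perm col _ hperm, cnt_perm col _ hperm]
    exact hcond0
  have hd : ∀ x ∈ l, 0 < cr d (x - p) := fun x hx => hd0 x (hperm.mem_iff.mp hx)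
  rw [← hperm.length_eq] at hlen
  unfold Sol
  rw [hset] at hgp0 ⊢
  change Sol col k p c l
  clear hset hcond0 hd0 hnod0 hperm
  -- the two kinds of recursive calls
  have callP : ∀ l1 l2 c', (l = l1 ++ l2 ∧ l2 ≠ [] ∨ l = l2 ++ l1 ∧ l2 ≠ []) →
      Cond col k (col p) c' l1 → Sol col k p c' l1 := by
    intro l1 l2 c' hl hC
    have hsub : l1.Sublist l := by
      rcases hl with ⟨rfl, _⟩ | ⟨rfl, _⟩ <;> simp
    have hlt : l1.length < l.length := by
      rcases hl with ⟨rfl, h⟩ | ⟨rfl, h⟩ <;> simpa [List.length_pos_iff] using h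
    refine ih l1 (by omega) p d c' (hnod.sublist hsub) (GenPos.sub hgp0 ?_)
      (fun x hx => hd x (hsub.subset hx)) hC
    intro x hx
    simp at hx ⊢
    exact hx.imp id (fun h => hsub.subset h)
  have callQ : ∀ q l1 d' c', col q = !(col p) → q ∈ l → l1.Sublist l → l1.length < l.length →
      (∀ x ∈ l1, 0 < cr d' (x - q)) → Cond col k (!(col p)) c' l1 → Sol col k q c' l1 := by
    intro q l1 d' c' hq hql hsub hlt hd' hC
    refine ih l1 (by omega) q d' c' (hnod.sublist hsub) (GenPos.sub hgp0 ?_) hd' (by rwa [hq])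
    intro x hx
    simp at hx ⊢
    rcases hx with rfl | hx
    · exact Or.inr hql
    · exact Or.inr (hsub.subset hx)
  -- combining at an edge `p q`
  have comb : ∀ l1 q l2 r c1 c2, l = l1 ++ q :: l2 ++ r → col q = !(col p) → c1 + c2 ≤ k →
      (l1 = [] ∨ Cond col k (!(col p)) c1 l1) → (l2 = [] ∨ Cond col k (!(col p)) c2 l2) →
      Sol col k p 1 (l1 ++ q :: l2) := by
    intro l1 q l2 r c1 c2 hl hq hc hC1 hC2
    have hql : q ∈ l := by rw [hl]; simp
    have hsort' := hsort
    rw [hl, List.pairwise_append] at hsort'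
    have hsort2 := hsort'.1
    rw [List.pairwise_append, List.pairwise_cons] at hsort2
    obtain ⟨_, ⟨hq2, _⟩, hq1⟩ := hsort2
    have hg1 : ∀ x ∈ l1, 0 < cr (x - p) (q - p) := fun x hx => hq1 x hx q (by simp)
    refine op_two col k p q l1 l2 c1 c2 (GenPos.sub hgp0 ?_) (by rw [hq]; simp) hg1 hq2 hc ?_ ?_
    · intro x hx
      rw [hl]
      simp at hx ⊢
      tauto
    · rcases hC1 with rfl | hC1
      · exact sol_nil _ _ _ _
      · refine callQ q l1 (p - q) c1 hq hql (by rw [hl]; simp) (by rw [hl]; simp) ?_ hC1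
        intro x hx
        have := hg1 x hx
        simp only [cr, Prod.fst_sub, Prod.snd_sub] at this ⊢
        linarith
    · rcases hC2 with rfl | hC2
      · exact sol_nil _ _ _ _
      · refine callQ q l2 (q - p) c2 hq hql ?_ (by rw [hl]; simp; omega) ?_ hC2
        · rw [hl]
          exact (((List.Sublist.refl l2).cons q).trans (List.sublist_append_right l1 _)).trans
            (List.sublist_append_left _ _)
        · intro x hx
          have := hq2 x hx
          simp only [cr, Prod.fst_sub, Prod.snd_sub] at this ⊢
          linarith
  have split : ∀ l1 l2 c1 c2, l = l1 ++ l2 → l1 ≠ [] → l2 ≠ [] → c1 + c2 ≤ c →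
      Sol col k p c1 l1 → Sol col k p c2 l2 → Sol col k p c l := by
    intro l1 l2 c1 c2 hl h1 h2 hc S1 S2
    rw [hl] at hsort hgp0 ⊢
    obtain ⟨n, hn1, hn2⟩ := sep_dir p l1 l2 h1 h2 hsort
    exact (op_one col k p n l1 l2 c1 c2 hgp0 hn1 hn2 S1 S2).mono hc
  have hc1 : 1 ≤ c := hcond.1
  by_cases hbig : k * cnt col (col p) l + 2 ≤ cnt col (!(col p)) l
  · obtain ⟨l1, l2, c2, e, n1, n2, hc, C1, C2⟩ := comb_one col k (col p) l c hk hcond hbig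
    exact split l1 l2 1 c2 e n1 n2 hc (callP l1 l2 1 (Or.inl ⟨e, n2⟩) C1)
      (callP l2 l1 c2 (Or.inr ⟨e, n1⟩) C2)
  obtain ⟨_, hck, hw, hw'⟩ := hcond
  rcases l with _ | ⟨x, m⟩
  · exact sol_nil _ _ _ _
  by_cases hx : col x = col p
  swap
  · -- first point has the opposite colour
    have hx' : col x = !(col p) := by revert hx; cases col x <;> cases col p <;> simp
    refine (comb [] x m [] 0 k (by simp) hx' (by omega) (Or.inl rfl) (Or.inr ?_)).mono hc1
    rw [cnt_cons_ne col _ _ _ hx, cnt_cons_eq col _ _ _ hx'] at *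
    rw [Nat.mul_add] at hw
    refine ⟨by omega, le_refl _, ?_, ?_⟩
    · rw [Bool.not_not, if_neg (by omega)]; omega
    · rw [Bool.not_not]; omega
  rcases List.eq_nil_or_concat m with rfl | ⟨m, y, rfl⟩
  · exfalso
    have hx' : col x ≠ !(col p) := by rw [hx]; cases col p <;> simp
    rw [cnt_cons_eq col _ _ _ hx, cnt_cons_ne col _ _ _ hx'] at hw
    simp [cnt_nil] at hw
  rw [List.concat_eq_append] at *
  by_cases hy : col y = col p
  swap
  · -- last point has the opposite colour
    have hy' : col y = !(col p) := by revert hy; cases col y <;> cases col p <;> simp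
    have := comb (x :: m) y [] [] k 0 (by simp) hy' (by omega) (Or.inr ?_) (Or.inl rfl)
    · exact Sol.mono (by simpa using this) hc1
    · rw [← List.cons_append, cnt_append, cnt_append, cnt_cons_ne col _ y _ hy,
        cnt_cons_eq col _ y _ hy', cnt_nil, cnt_nil] at *
      simp only [Nat.zero_add, Nat.add_zero] at *
      rw [Nat.mul_add] at hw
      refine ⟨by omega, le_refl _, ?_, ?_⟩
      · rw [Bool.not_not, if_neg (by omega)]; omega
      · rw [Bool.not_not]; omega
  by_cases hstrict : cnt col (col p) (x :: (m ++ [y])) + 1 ≤ k * cnt col (!(col p)) (x :: (m ++ [y]))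
  · obtain ⟨l1, q, l2, c1, c2, e, hq, hc, C1, C2⟩ :=
      comb_two col k (col p) x y m hk hx hy hstrict (by omega)
    have := comb l1 q l2 [] c1 c2 (by simp [e]) hq (by omega) (Or.inr C1) (Or.inr C2)
    rw [← e] at this
    exact this.mono hc1
  · have hc2 : 2 ≤ c := by
      by_contra hcc
      rw [if_pos (by omega)] at hw
      exact hstrict hw
    rw [if_neg (by omega)] at hw
    obtain ⟨l1, q, l2, e, hq, hcase⟩ := comb_three col k (col p) x (m ++ [y]) hk hx (by omega)
    rcases hcase with ⟨c1, c2, hc, C1, C2⟩ | ⟨C1, rfl | ⟨q', l3, rfl, hq', C3⟩⟩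
    · have := comb l1 q l2 [] c1 c2 (by simp [e]) hq (by omega) (Or.inr C1) (Or.inr C2)
      rw [← e] at this
      exact this.mono hc1
    · have := comb l1 q [] [] k 0 (by simp [e]) hq (by omega) (Or.inr C1) (Or.inl rfl)
      rw [← e] at this
      exact this.mono hc1
    · have S1 := comb l1 q [] (q' :: l3) k 0 (by simp [e]) hq (by omega) (Or.inr C1) (Or.inl rfl)
      -- second half: again an edge from `p`
      have S2 : Sol col k p 1 (q' :: l3) := by
        have hql : q' ∈ x :: (m ++ [y]) := by rw [e]; simp
        have hsort' := hsort
        rw [e, List.pairwise_append, List.pairwise_cons, List.pairwise_cons] at hsort'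
        have hq2 := hsort'.2.1.2.1
        refine op_two col k p q' [] l3 0 k (GenPos.sub hgp0 ?_) (by rw [hq']; simp) (by simp) hq2
          (by omega) (sol_nil _ _ _ _) ?_
        · intro z hz
          rw [e]
          simp at hz ⊢
          tauto
        · refine callQ q' l3 (q' - p) k hq' hql ?_ (by rw [e]; simp; omega) ?_ C3
          · rw [e]
            exact (((List.Sublist.refl l3).cons q').cons q).trans (List.sublist_append_right l1 _)
          · intro z hz
            have := hq2 z hz
            simp only [cr, Prod.fst_sub, Prod.snd_sub] at this ⊢
            linarith
      exact split (l1 ++ [q]) (q' :: l3) 1 1 (by simp [e]) (by simp) (by simp) hc2 S1 S2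

lemma exists_extreme (V : Finset Pt) (hV : V.Nonempty) :
    ∃ p ∈ V, ∃ d : Pt, ∀ x ∈ V, x ≠ p → 0 < cr d (x - p) := by
  let bad : Finset ℝ := (V ×ˢ V).image (fun z => -(z.1.1 - z.2.1) / (z.1.2 - z.2.2))
  obtain ⟨t, ht⟩ := Infinite.exists_notMem_finset bad
  obtain ⟨p, hp, hmin⟩ := V.exists_min_image (fun z => z.1 + t * z.2) hV
  refine ⟨p, hp, (t, -1), ?_⟩
  intro x hx hne
  have h1 := hmin x hx
  have h2 : p.1 + t * p.2 ≠ x.1 + t * x.2 := by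
    intro he
    by_cases h3 : x.2 - p.2 = 0
    · have h4 : x.2 = p.2 := by linarith
      rw [h4] at he
      exact hne (Prod.ext (by linarith) h4)
    · apply ht
      simp only [bad, Finset.mem_image, Finset.mem_product]
      refine ⟨(x, p), ⟨hx, hp⟩, ?_⟩
      simp only
      rw [div_eq_iff h3]
      linarith
  have h5 := lt_of_le_of_ne h1 h2
  simp only [cr, Prod.fst_sub, Prod.snd_sub]
  linarith

lemma reach_sub (V : Set Pt) (G : SimpleGraph Pt) (hm : ∀ u v, G.Adj u v → u ∈ V) (x y : Pt)
    (hx : x ∈ V) (hy : y ∈ V) (h : G.Reachable x y) :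
    (G.comap (Subtype.val : {x // x ∈ V} → Pt)).Reachable ⟨x, hx⟩ ⟨y, hy⟩ := by
  obtain ⟨w⟩ := h
  induction w with
  | nil => exact SimpleGraph.Reachable.refl _
  | cons hadj w ih =>
    have hv := hm _ _ hadj.symm
    refine SimpleGraph.Reachable.trans ?_ (ih hv hy)
    apply SimpleGraph.Adj.reachable
    exact hadj

end PBT

/-- If `(k-1)|B| < |R| < k|B|` with `k ≥ 2` and `R ∪ B` is in general
position, then there is a plane bichromatic tree on `R ∪ B` of maximum degree at most
`max {5, k + 1}`. -/
theorem statement_7 (R B : Finset Pt) (hdisj : Disjoint R B)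
    (hgp : GenPos (↑(R ∪ B) : Set Pt)) (k : ℕ) (hk : 2 ≤ k)
    (hlo : (k - 1) * B.card < R.card) (hhi : R.card < k * B.card) :
    ∃ G : SimpleGraph {x : Pt // x ∈ R ∪ B},
      PlaneBichromTree R B G ∧ ∀ v, deg G v ≤ max 5 (k + 1) := by
  obtain ⟨K, hK4, hKeq, hkK⟩ : ∃ K, 4 ≤ K ∧ max 5 (k + 1) = K + 1 ∧ k ≤ K :=
    ⟨max 4 k, by omega, by omega, by omega⟩
  have hBpos : 0 < B.card := by
    rcases Nat.eq_zero_or_pos B.card with h | h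
    · rw [h] at hhi; simp at hhi
    · exact h
  have hmn : B.card ≤ R.card := by
    have : 1 * B.card ≤ (k - 1) * B.card := Nat.mul_le_mul_right _ (by omega)
    omega
  have hmK : R.card ≤ K * B.card := by
    have : k * B.card ≤ K * B.card := Nat.mul_le_mul_right _ hkK
    omega
  let col : Pt → Bool := fun x => decide (x ∈ R)
  obtain ⟨p, hp, d, hd⟩ := PBT.exists_extreme (R ∪ B) (by
    obtain ⟨b, hb⟩ := Finset.card_pos.mp hBpos
    exact ⟨b, by simp [hb]⟩)
  have hcount : ∀ b, PBT.cnt col b (R ∪ B).toList = if b then R.card else B.card := by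
    intro b
    have h1 : PBT.cnt col b (R ∪ B).toList = ((R ∪ B).filter (fun x => col x = b)).card := by
      unfold PBT.cnt
      rw [List.count, List.countP_map, List.countP_eq_length_filter,
        ← List.toFinset_card_of_nodup ((Finset.nodup_toList _).filter _)]
      congr 1
      ext x
      simp
    rw [h1]
    cases b
    · simp only [Bool.false_eq_true, if_false]
      congr 1
      ext x
      simp only [Finset.mem_filter, Finset.mem_union, col, decide_eq_false_iff_not]
      constructor
      · rintro ⟨h | h, h'⟩
        · exact absurd h h'
        · exact h
      · intro h
        exact ⟨Or.inr h, fun h' => Finset.disjoint_left.mp hdisj h' h⟩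
    · simp only [if_true]
      congr 1
      ext x
      simp only [Finset.mem_filter, Finset.mem_union, col, decide_eq_true_eq]
      tauto
  have hp' : p ∈ (R ∪ B).toList := by simpa using hp
  have hperm := List.perm_cons_erase hp'
  set l := (R ∪ B).toList.erase p with hl
  have hnod : (p :: l).Nodup := hperm.nodup_iff.mp (Finset.nodup_toList _)
  have hmem : ∀ x, x ∈ p :: l ↔ x ∈ R ∪ B := by
    intro x
    rw [← hperm.mem_iff, Finset.mem_toList]
  have hset : ({x | x ∈ p :: l} : Set Pt) = (↑(R ∪ B) : Set Pt) := by
    ext x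
    rw [Set.mem_ofPred_eq, hmem, Finset.mem_coe]
  have hsol : PBT.Sol col K p K l := by
    refine PBT.main col K hK4 (l.length + 1) l (by omega) p d K (List.nodup_cons.mp hnod).2
      (by rw [hset]; exact hgp) ?_ ?_
    · intro x hx
      refine hd x ((hmem x).1 (List.mem_cons_of_mem _ hx)) ?_
      rintro rfl
      exact (List.nodup_cons.mp hnod).1 hx
    · have hc1 := hcount (col p)
      have hc2 := hcount (!(col p))
      rw [PBT.cnt_perm col _ hperm, PBT.cnt_cons_eq col _ _ _ rfl] at hc1
      rw [PBT.cnt_perm col _ hperm, PBT.cnt_cons_ne col _ _ _ (by cases col p <;> simp)] at hc2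
      have g1 : 4 * R.card ≤ K * R.card := Nat.mul_le_mul_right _ hK4
      have e1 : K * (PBT.cnt col (col p) l + 1) = K * PBT.cnt col (col p) l + K := by ring
      refine ⟨by omega, le_refl _, ?_, ?_⟩
      · rw [if_neg (by omega), hc2]
        rcases hcp : col p <;> simp [hcp] at hc1 ⊢ <;> omega
      · rw [hc2]
        rw [hc1] at e1
        rcases hcp : col p <;> simp [hcp] at e1 ⊢ <;> omega
  obtain ⟨G, HG, hdp, hdv⟩ := hsol
  rw [hset] at HG
  have hdeg : ∀ v, deg G v ≤ K + 1 := by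
    intro v
    by_cases h : v = p
    · rw [h]; omega
    · exact hdv v h
  let G' : SimpleGraph {x : Pt // x ∈ R ∪ B} := G.comap Subtype.val
  have hconn : G'.Connected := by
    have : Nonempty {x : Pt // x ∈ R ∪ B} := ⟨⟨p, hp⟩⟩
    refine SimpleGraph.Connected.mk ?_
    intro x y
    exact PBT.reach_sub (↑(R ∪ B) : Set Pt) G HG.mem x.1 y.1 x.2 y.2
      (HG.conn x.1 x.2 y.1 y.2)
  obtain ⟨T, hTle, hT⟩ := hconn.exists_isTree_le
  have hTG : ∀ u v, T.Adj u v → G.Adj u.1 v.1 := fun u v h => hTle h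
  refine ⟨T, ⟨hT, ?_, ?_⟩, ?_⟩
  · intro u v h
    have hb := HG.bi _ _ (hTG u v h)
    have hu := Finset.mem_union.mp u.2
    have hv := Finset.mem_union.mp v.2
    by_cases h1 : u.1 ∈ R <;> by_cases h2 : v.1 ∈ R
    · exact absurd (by simp [col, h1, h2]) hb
    · exact Or.inl ⟨h1, hv.resolve_left h2⟩
    · exact Or.inr ⟨hu.resolve_left h1, h2⟩
    · exact absurd (by simp [col, h1, h2]) hb
  · intro u v x y h1 h2 hne
    refine HG.plane u.1 v.1 x.1 y.1 (hTG _ _ h1) (hTG _ _ h2) ?_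
    intro he
    apply hne
    rw [Sym2.eq_iff] at he ⊢
    rcases he with ⟨a, b⟩ | ⟨a, b⟩
    · exact Or.inl ⟨Subtype.ext a, Subtype.ext b⟩
    · exact Or.inr ⟨Subtype.ext a, Subtype.ext b⟩
  · intro v
    rw [hKeq]
    refine le_trans ?_ (hdeg v.1)
    unfold deg
    refine Set.ncard_le_ncard_of_injOn Subtype.val (fun w hw => hTG v w hw)
      Subtype.val_injective.injOn ?_
    refine Set.Finite.subset (R ∪ B).finite_toSet ?_
    intro w hw
    exact HG.mem w v.1 hw.symm
end
end
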